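/- arXiv:1702.00628 — 6 statements merged into one kernel-verified Lean document; each statement's English description precedes it below -/
import Mathlib

section
/- The multivariate skew Laplace density integrates to one: for every integer p ≥ 1, every μ, γ ∈ ℝ^p and every symmetric positive definite p×p real matrix Σ, with α = √(1 + γᵀΣ⁻¹γ), one has ∫_{ℝ^p} |Σ|^{-1/2} / (2^p · π^{(p-1)/2} · α · Γ((p+1)/2)) · exp( −α·√((y−μ)ᵀΣ⁻¹(y−μ)) + (y−μ)ᵀΣ⁻¹γ ) dy = 1. -/
open MeasureTheory Real Matrix

theorem integral_exp_neg_sq_div_add_mul {v : ℝ} (hv : 0 < v) (g : ℝ) :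
    ∫ x : ℝ, rexp (-x ^ 2 / (2 * v) + x * g) = √(2 * π * v) * rexp (v * g ^ 2 / 2) := by
  have h : ∀ x : ℝ, rexp (-x ^ 2 / (2 * v) + x * g) =
      rexp (-(1 / (2 * v)) * (x - v * g) ^ 2) * rexp (v * g ^ 2 / 2) := by
    intro x
    rw [← Real.exp_add]
    congr 1
    field_simp
    ring
  simp_rw [h]
  rw [integral_mul_const, integral_sub_right_eq_self (fun x => rexp (-(1 / (2 * v)) * x ^ 2)),
    integral_gaussian]
  congr 2
  field_simp

theorem integral_exp_neg_dotProduct_div_add {p : ℕ} {v : ℝ} (hv : 0 < v) (g : Fin p → ℝ) :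
    ∫ x : Fin p → ℝ, rexp (-(x ⬝ᵥ x) / (2 * v) + x ⬝ᵥ g) =
      √(2 * π * v) ^ p * rexp (v * (g ⬝ᵥ g) / 2) := by
  have h : ∀ x : Fin p → ℝ, rexp (-(x ⬝ᵥ x) / (2 * v) + x ⬝ᵥ g) =
      ∏ i, rexp (-x i ^ 2 / (2 * v) + x i * g i) := by
    intro x
    rw [← Real.exp_sum, Finset.sum_add_distrib, ← Finset.sum_div, Finset.sum_neg_distrib]
    simp only [dotProduct, pow_two]
  simp_rw [h]
  rw [integral_fintype_prod_volume_eq_prod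
    (fun i (t : ℝ) => rexp (-t ^ 2 / (2 * v) + t * g i))]
  simp_rw [integral_exp_neg_sq_div_add_mul hv]
  rw [Finset.prod_mul_distrib, ← Real.exp_sum]
  simp only [Finset.prod_const, Finset.card_univ, Fintype.card_fin, dotProduct, pow_two,
    Finset.mul_sum, Finset.sum_div]

theorem integral_inv_sqrt_mul_exp_neg_div_sub {a r : ℝ} (ha : 0 < a) (hr : 0 < r) :
    ∫ v in Set.Ioi (0 : ℝ), (√v)⁻¹ * rexp (-r ^ 2 / (2 * v) - a ^ 2 * v / 2) =
      √(2 * π) / a * rexp (-(a * r)) := by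
  set w : ℝ → ℝ := fun u => √(u ^ 2 + 4 * a * r) with hw
  set t : ℝ → ℝ := fun u => (u + w u) / (2 * a) with ht
  have hc : 0 < 4 * a * r := by positivity
  have hw0 : ∀ u, 0 < w u := fun u => Real.sqrt_pos.2 (by positivity)
  have hwsq : ∀ u, w u ^ 2 = u ^ 2 + 4 * a * r := fun u => Real.sq_sqrt (by positivity)
  have ht0 : ∀ u, 0 < t u := by
    intro u
    have : 0 < u + w u := by
      have := abs_lt_of_sq_lt_sq (a := u) (b := w u) (by rw [hwsq]; linarith) (hw0 u).le
      linarith [neg_abs_le u]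
    simp only [ht]; positivity
  have htw : ∀ u, 2 * a * t u = u + w u := by intro u; simp only [ht]; field_simp
  have hu : ∀ u, a * t u - r / t u = u := by
    intro u
    have h1 := ht0 u
    field_simp
    have : 4 * a * (a * t u ^ 2 - r - t u * u) = 0 := by
      linear_combination (2 * a * t u - u + w u) * htw u + hwsq u
    have := (mul_eq_zero.1 this).resolve_left (by positivity)
    linarith
  have himg : (fun u => t u ^ 2) '' Set.univ = Set.Ioi 0 := by
    ext v
    simp only [Set.image_univ, Set.mem_range, Set.mem_Ioi]
    constructor
    · rintro ⟨u, rfl⟩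
      exact pow_pos (ht0 u) 2
    · intro hv
      have hs : 0 < √v := Real.sqrt_pos.2 hv
      refine ⟨a * √v - r / √v, ?_⟩
      have : w (a * √v - r / √v) = a * √v + r / √v := by
        simp only [hw]
        rw [Real.sqrt_eq_iff_mul_self_eq (by positivity) (by positivity)]
        field_simp
        ring
      simp only [ht]
      rw [this]
      have : (a * √v - r / √v + (a * √v + r / √v)) / (2 * a) = √v := by field_simp; ring
      rw [this, Real.sq_sqrt hv.le]
  have hinj : Set.InjOn (fun u => t u ^ 2) Set.univ := by
    intro u _ u' _ h
    have : t u = t u' := (pow_left_inj₀ (ht0 u).le (ht0 u').le two_ne_zero).1 h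
    rw [← hu u, ← hu u', this]
  have hder : ∀ u ∈ Set.univ, HasDerivWithinAt (fun u => t u ^ 2) (2 * t u ^ 2 / w u)
      Set.univ u := by
    intro u _
    have h1 : HasDerivAt w (u / w u) u := by
      have := (((hasDerivAt_id u).pow 2).add_const (4 * a * r)).sqrt
        (by simp only [id, Pi.pow_apply]; positivity)
      refine this.congr_deriv ?_
      change (2 : ℕ) * u ^ (2 - 1) * 1 / (2 * w u) = u / w u
      have := hw0 u
      field_simp
      norm_num
    have h2 := (((hasDerivAt_id u).add h1).div_const (2 * a)).pow 2
    refine (h2.congr_deriv ?_).hasDerivWithinAt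
    have := hw0 u
    have e : 1 + u / w u = 2 * a * t u / w u := by rw [htw]; field_simp; ring
    rw [e]
    change (2 : ℕ) * t u ^ (2 - 1) * _ = _
    field_simp
    norm_num
    ring
  have hker : ∀ u, |2 * t u ^ 2 / w u| •
      ((√(t u ^ 2))⁻¹ * rexp (-r ^ 2 / (2 * t u ^ 2) - a ^ 2 * t u ^ 2 / 2)) =
      (rexp (-(a * r)) / a) *
        (rexp (-(1 / 2) * u ^ 2) + u / w u * rexp (-(1 / 2) * u ^ 2)) := by
    intro u
    have h1 := ht0 u
    have h2 := hw0 u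
    have e : -r ^ 2 / (2 * t u ^ 2) - a ^ 2 * t u ^ 2 / 2 =
        -(a * r) + -(1 / 2) * u ^ 2 := by
      nth_rewrite 3 [← hu u]
      field_simp
      ring
    rw [e, Real.exp_add, Real.sqrt_sq h1.le, abs_of_pos (by positivity), smul_eq_mul]
    field_simp
    linear_combination htw u
  have hg : Integrable (fun u : ℝ => rexp (-(1 / 2) * u ^ 2)) :=
    integrable_exp_neg_mul_sq (by norm_num)
  have hwc : Continuous w := by simp only [hw]; fun_prop
  have hodd : Integrable (fun u : ℝ => u / w u * rexp (-(1 / 2) * u ^ 2)) := by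
    refine hg.bdd_mul (c := 1) ?_ (ae_of_all _ fun u => ?_)
    · exact (continuous_id.div hwc fun u => (hw0 u).ne').aestronglyMeasurable
    · rw [norm_div, div_le_one (by simpa using (hw0 u).ne')]
      rw [Real.norm_eq_abs, Real.norm_eq_abs]
      exact sq_le_sq.1 (by rw [hwsq]; linarith)
  have hodd0 : ∫ u : ℝ, u / w u * rexp (-(1 / 2) * u ^ 2) = 0 := by
    have h := integral_neg_eq_self (fun u : ℝ => u / w u * rexp (-(1 / 2) * u ^ 2)) volume
    have hwn : ∀ u, w (-u) = w u := by intro u; simp [hw]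
    simp only [hwn, neg_sq, neg_div, neg_mul, integral_neg] at h hodd ⊢
    linarith
  rw [← himg, integral_image_eq_integral_abs_deriv_smul MeasurableSet.univ hder hinj]
  simp_rw [hker]
  rw [setIntegral_univ, integral_const_mul, integral_add hg hodd, hodd0, integral_gaussian]
  rw [show π / (1 / 2) = 2 * π by ring]
  ring

theorem lintegral_exp_neg_mul_sqrt_add {p : ℕ} (hp : 1 ≤ p) (g : Fin p → ℝ) :
    ∫⁻ x : Fin p → ℝ,
      ENNReal.ofReal (rexp (-(√(1 + g ⬝ᵥ g)) * √(x ⬝ᵥ x) + x ⬝ᵥ g)) =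
    ENNReal.ofReal ((2 : ℝ) ^ p * π ^ (((p : ℝ) - 1) / 2) * √(1 + g ⬝ᵥ g) *
      Real.Gamma (((p : ℝ) + 1) / 2)) := by
  have hgg : 0 ≤ g ⬝ᵥ g := by simpa using dotProduct_star_self_nonneg g
  set a := √(1 + g ⬝ᵥ g) with ha
  have ha0 : 0 < a := Real.sqrt_pos.2 (by linarith)
  have hasq : a ^ 2 = 1 + g ⬝ᵥ g := Real.sq_sqrt (by linarith)
  have : Nonempty (Fin p) := ⟨⟨0, hp⟩⟩
  set F : (Fin p → ℝ) → ℝ → ℝ := fun x v =>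
    a / √(2 * π) * rexp (x ⬝ᵥ g) *
      ((√v)⁻¹ * rexp (-√(x ⬝ᵥ x) ^ 2 / (2 * v) - a ^ 2 * v / 2)) with hF
  have hF0 : ∀ x v, 0 ≤ F x v := fun x v => by simp only [hF]; positivity
  have hx0 : ∀ᵐ x : Fin p → ℝ, x ≠ 0 := by
    simp [ae_iff, measure_singleton]
  have hxx : ∀ x : Fin p → ℝ, 0 ≤ x ⬝ᵥ x := fun x => by
    simpa using dotProduct_star_self_nonneg x
  have h1 : ∫⁻ x : Fin p → ℝ, ENNReal.ofReal (rexp (-a * √(x ⬝ᵥ x) + x ⬝ᵥ g)) =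
      ∫⁻ x : Fin p → ℝ, ∫⁻ v in Set.Ioi (0 : ℝ), ENNReal.ofReal (F x v) := by
    refine lintegral_congr_ae (hx0.mono fun x hx => ?_)
    have hr : 0 < √(x ⬝ᵥ x) := Real.sqrt_pos.2 (lt_of_le_of_ne (hxx x)
      (Ne.symm (by simpa [dotProduct_self_eq_zero] using hx)))
    have hI : ∫ v in Set.Ioi (0 : ℝ), F x v = rexp (-a * √(x ⬝ᵥ x) + x ⬝ᵥ g) := by
      simp only [hF]
      rw [integral_const_mul, integral_inv_sqrt_mul_exp_neg_div_sub ha0 hr, Real.exp_add]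
      field_simp
    have hint : Integrable (F x) (volume.restrict (Set.Ioi 0)) :=
      Integrable.of_integral_ne_zero (by rw [hI]; positivity)
    dsimp only
    rw [← hI, ofReal_integral_eq_lintegral_ofReal hint (ae_of_all _ (hF0 x))]
  have hmeas : Measurable (Function.uncurry F) := by
    simp only [hF, Function.uncurry_def, dotProduct]
    fun_prop
  have h2 : ∫⁻ v in Set.Ioi (0 : ℝ), ∫⁻ x : Fin p → ℝ, ENNReal.ofReal (F x v) =
      ∫⁻ v in Set.Ioi (0 : ℝ), ENNReal.ofReal (a * √(2 * π) ^ (p - 1) *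
        (v ^ (((p : ℝ) + 1) / 2 - 1) * rexp (-(1 / 2 * v)))) := by
    refine setLIntegral_congr_fun measurableSet_Ioi fun v hv => ?_
    have hv : 0 < v := hv
    have hI : ∫ x : Fin p → ℝ, F x v = a * √(2 * π) ^ (p - 1) *
        (v ^ (((p : ℝ) + 1) / 2 - 1) * rexp (-(1 / 2 * v))) := by
      have h : ∀ x, F x v = a / √(2 * π) * (√v)⁻¹ * rexp (-(a ^ 2 * v / 2)) *
          rexp (-(x ⬝ᵥ x) / (2 * v) + x ⬝ᵥ g) := by
        intro x
        simp only [hF]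
        rw [Real.sq_sqrt (hxx x), sub_eq_add_neg, Real.exp_add, Real.exp_add]
        ring
      simp_rw [h]
      rw [integral_const_mul, integral_exp_neg_dotProduct_div_add hv]
      have e1 : rexp (-(a ^ 2 * v / 2)) * rexp (v * (g ⬝ᵥ g) / 2) = rexp (-(1 / 2 * v)) := by
        rw [← Real.exp_add, hasq]; congr 1; ring
      have e2 : v ^ (((p : ℝ) + 1) / 2 - 1) = √v ^ (p - 1) := by
        rw [Real.sqrt_eq_rpow, ← Real.rpow_natCast, ← Real.rpow_mul hv.le, Nat.cast_sub hp]
        congr 1; push_cast; ring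
      rw [← e1, e2, Real.sqrt_mul (show 0 ≤ 2 * π by positivity) v]
      have hs : 0 < √v := Real.sqrt_pos.2 hv
      obtain ⟨q, rfl⟩ : ∃ q, p = q + 1 := ⟨p - 1, by omega⟩
      simp only [Nat.add_sub_cancel]
      field_simp
      ring
    have hint : Integrable (fun x => F x v) :=
      Integrable.of_integral_ne_zero (by rw [hI]; positivity)
    rw [← hI, ofReal_integral_eq_lintegral_ofReal hint (ae_of_all _ fun x => hF0 x v)]
  have h3 : ∫ v in Set.Ioi (0 : ℝ), a * √(2 * π) ^ (p - 1) *
        (v ^ (((p : ℝ) + 1) / 2 - 1) * rexp (-(1 / 2 * v))) =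
      (2 : ℝ) ^ p * π ^ (((p : ℝ) - 1) / 2) * a * Real.Gamma (((p : ℝ) + 1) / 2) := by
    rw [integral_const_mul, Real.integral_rpow_mul_exp_neg_mul_Ioi (by positivity) (by norm_num)]
    have e1 : √(2 * π) ^ (p - 1) = 2 ^ (((p : ℝ) - 1) / 2) * π ^ (((p : ℝ) - 1) / 2) := by
      rw [← Real.mul_rpow (by norm_num) pi_pos.le, Real.sqrt_eq_rpow, ← Real.rpow_natCast,
        ← Real.rpow_mul (by positivity), Nat.cast_sub hp]
      congr 1; push_cast; ring
    have e2 : (2 : ℝ) ^ p = 2 ^ (((p : ℝ) - 1) / 2) * 2 ^ (((p : ℝ) + 1) / 2) := by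
      rw [← Real.rpow_natCast, ← Real.rpow_add (by norm_num)]
      congr 1; ring
    rw [e1, e2]
    norm_num
    ring
  have hpos : 0 < (2 : ℝ) ^ p * π ^ (((p : ℝ) - 1) / 2) * a * Real.Gamma (((p : ℝ) + 1) / 2) := by
    have := Real.Gamma_pos_of_pos (s := ((p : ℝ) + 1) / 2) (by positivity)
    positivity
  rw [h1, lintegral_lintegral_swap hmeas.ennreal_ofReal.aemeasurable, h2, ← h3,
    ofReal_integral_eq_lintegral_ofReal (Integrable.of_integral_ne_zero (by rw [h3]; exact hpos.ne'))]
  filter_upwards [ae_restrict_mem measurableSet_Ioi] with v hv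
  have hv : 0 < v := hv
  simp only [Pi.zero_apply]
  positivity

theorem integral_exp_neg_mul_sqrt_add {p : ℕ} (hp : 1 ≤ p) (g : Fin p → ℝ) :
    ∫ x : Fin p → ℝ, rexp (-(√(1 + g ⬝ᵥ g)) * √(x ⬝ᵥ x) + x ⬝ᵥ g) =
      (2 : ℝ) ^ p * π ^ (((p : ℝ) - 1) / 2) * √(1 + g ⬝ᵥ g) *
        Real.Gamma (((p : ℝ) + 1) / 2) := by
  rw [integral_eq_lintegral_of_nonneg_ae (ae_of_all _ fun x => (Real.exp_pos _).le),
    lintegral_exp_neg_mul_sqrt_add hp, ENNReal.toReal_ofReal]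
  · have := Real.Gamma_pos_of_pos (s := ((p : ℝ) + 1) / 2) (by positivity)
    positivity
  · refine Continuous.aestronglyMeasurable ?_
    simp only [dotProduct]
    fun_prop

open scoped MatrixOrder Matrix.Norms.L2Operator in
theorem Matrix.PosDef.exists_eq_transpose_mul_self {n : Type*} [Fintype n] [DecidableEq n]
    {S : Matrix n n ℝ} (hS : S.PosDef) : ∃ B : Matrix n n ℝ, S = Bᵀ * B := by
  obtain ⟨B, hB⟩ := CStarAlgebra.nonneg_iff_eq_star_mul_self.mp hS.posSemidef.nonneg
  exact ⟨B, by rw [hB, star_eq_conjTranspose, conjTranspose_eq_transpose_of_trivial]⟩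

theorem integral_comp_mulVec {n : Type*} [Fintype n] [DecidableEq n] {M : Matrix n n ℝ}
    (hM : M.det ≠ 0) (f : (n → ℝ) → ℝ) :
    ∫ x, f (M *ᵥ x) = |M.det|⁻¹ * ∫ x, f x := by
  have hemb : MeasurableEmbedding (toLin' M) := by
    have hinj : Function.Injective (toLin' M) := by
      intro x y h
      exact mulVec_injective_iff_isUnit.2 ((isUnit_iff_isUnit_det M).2 hM.isUnit)
        (by simpa only [toLin'_apply] using h)
    exact (LinearMap.continuous_of_finiteDimensional _).measurableEmbedding hinj
  have := hemb.integral_map (μ := volume) f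
  rw [Real.map_matrix_volume_pi_eq_smul_volume_pi hM, integral_smul_measure] at this
  simp only [toLin'_apply] at this
  rw [← this, ENNReal.toReal_ofReal (abs_nonneg _), abs_inv, smul_eq_mul]

/-- The multivariate skew Laplace density integrates to one. -/
theorem msl_density_integrates_to_one
    (p : ℕ) (hp : 1 ≤ p) (μ γ : Fin p → ℝ)
    (S : Matrix (Fin p) (Fin p) ℝ) (hS : S.PosDef) :
    ∫ y : Fin p → ℝ,
      S.det ^ (-(1:ℝ)/2) /
        ((2:ℝ) ^ p * π ^ (((p:ℝ) - 1)/2) *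
          Real.sqrt (1 + γ ⬝ᵥ S⁻¹ *ᵥ γ) * Real.Gamma (((p:ℝ) + 1)/2)) *
      Real.exp (-(Real.sqrt (1 + γ ⬝ᵥ S⁻¹ *ᵥ γ)) *
          Real.sqrt ((y - μ) ⬝ᵥ S⁻¹ *ᵥ (y - μ)) +
        (y - μ) ⬝ᵥ S⁻¹ *ᵥ γ) = 1 := by
  have hdet := hS.det_pos
  obtain ⟨B, rfl⟩ := hS.exists_eq_transpose_mul_self
  have hdetB : (Bᵀ * B).det = |B.det| ^ 2 := by
    rw [det_mul, det_transpose, sq_abs, pow_two]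
  have hB : B.det ≠ 0 := by
    intro h
    simp [hdetB, h] at hdet
  have hBt : Bᵀ.det ≠ 0 := by rwa [det_transpose]
  have hU : IsUnit B.det := hB.isUnit
  have hUt : IsUnit Bᵀ.det := hBt.isUnit
  set g : Fin p → ℝ := Bᵀ⁻¹ *ᵥ γ with hg
  have hγ : γ = Bᵀ *ᵥ g := by
    rw [hg, mulVec_mulVec, mul_nonsing_inv _ hUt, one_mulVec]
  have hquad : ∀ x z : Fin p → ℝ, (Bᵀ *ᵥ x) ⬝ᵥ (Bᵀ * B)⁻¹ *ᵥ (Bᵀ *ᵥ z) = x ⬝ᵥ z := by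
    intro x z
    rw [mulVec_transpose, ← dotProduct_mulVec, mulVec_mulVec, mulVec_mulVec, Matrix.mul_inv_rev,
      Matrix.mul_assoc, Matrix.mul_assoc, nonsing_inv_mul _ hUt, Matrix.mul_one,
      mul_nonsing_inv _ hU, one_mulVec]
  rw [integral_const_mul, integral_sub_right_eq_self (fun y : Fin p → ℝ =>
    rexp (-√(1 + γ ⬝ᵥ (Bᵀ * B)⁻¹ *ᵥ γ) * √(y ⬝ᵥ (Bᵀ * B)⁻¹ *ᵥ y) + y ⬝ᵥ (Bᵀ * B)⁻¹ *ᵥ γ))]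
  have h := integral_comp_mulVec hBt (fun y : Fin p → ℝ =>
    rexp (-√(1 + γ ⬝ᵥ (Bᵀ * B)⁻¹ *ᵥ γ) * √(y ⬝ᵥ (Bᵀ * B)⁻¹ *ᵥ y) + y ⬝ᵥ (Bᵀ * B)⁻¹ *ᵥ γ))
  rw [hγ] at h ⊢
  simp only [hquad] at h ⊢
  rw [integral_exp_neg_mul_sqrt_add hp, det_transpose] at h
  have habs : 0 < |B.det| := abs_pos.2 hB
  have hpow : (Bᵀ * B).det ^ (-(1 : ℝ) / 2) = |B.det|⁻¹ := by
    rw [hdetB, ← Real.rpow_natCast, ← Real.rpow_mul habs.le]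
    norm_num [Real.rpow_neg_one]
  rw [hpow, div_mul_eq_mul_div, ← h, div_self]
  have hgg : 0 ≤ g ⬝ᵥ g := by simpa using dotProduct_star_self_nonneg g
  have := Real.Gamma_pos_of_pos (s := ((p : ℝ) + 1) / 2) (by positivity)
  positivity
end

section
/- (Proposition 1) The characteristic function of the MSL_p(μ, Σ, γ) distribution is Φ(t) = e^{i tᵀμ} · (1 + tᵀΣt − 2i·tᵀγ)^{−(p+1)/2}; that is, for every t ∈ ℝ^p, ∫_{ℝ^p} exp(i·tᵀy) · f_MSL(y) dy = exp(i·tᵀμ) · (1 + tᵀΣt − 2i·tᵀγ)^{−(p+1)/2}, where the complex power is the principal branch (well defined since 1 + tᵀΣt ≥ 1 > 0). -/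
open MeasureTheory Real Matrix Complex

/-- A case of Glasser's master theorem: the substitution `u = a s - b / s` in a Gaussian. -/
theorem integral_exp_neg_sq_sub_inv_Ioi {a b : ℝ} (ha : 0 < a) (hb : 0 < b) :
    ∫ s in Set.Ioi (0 : ℝ), rexp (-(1 / 2) * (a * s - b / s) ^ 2) = √(2 * π) / (2 * a) := by
  set h : ℝ → ℝ := fun s ↦ rexp (-(1 / 2) * (a * s - b / s) ^ 2) with hdef
  have hder : ∀ s ∈ Set.Ioi (0 : ℝ), HasDerivWithinAt (fun s : ℝ ↦ a * s - b / s)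
      (a + b / s ^ 2) (Set.Ioi 0) s := by
    intro s hs
    have hs' : s ≠ 0 := (Set.mem_Ioi.mp hs).ne'
    have := ((hasDerivAt_id s).const_mul a).sub ((hasDerivAt_inv hs').const_mul b)
    refine (this.congr_deriv ?_).hasDerivWithinAt
    rw [mul_one, mul_neg, sub_neg_eq_add, div_eq_mul_inv]
  have hinj : Set.InjOn (fun s : ℝ ↦ a * s - b / s) (Set.Ioi 0) := by
    refine StrictMonoOn.injOn fun x hx y hy hxy ↦ ?_
    have hx' : 0 < x := hx
    have h1 : a * x < a * y := by gcongr
    have h2 : b / y < b / x := by gcongr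
    change a * x - b / x < a * y - b / y
    linarith
  have himg : (fun s : ℝ ↦ a * s - b / s) '' Set.Ioi 0 = Set.univ := by
    refine Set.eq_univ_of_forall fun u ↦ ?_
    have hlt : |u| < √(u ^ 2 + 4 * a * b) := by
      rw [← Real.sqrt_sq_eq_abs]
      exact Real.sqrt_lt_sqrt (sq_nonneg u) (by nlinarith [mul_pos ha hb])
    have hsq := Real.sq_sqrt (show 0 ≤ u ^ 2 + 4 * a * b by positivity)
    have hpos : 0 < u + √(u ^ 2 + 4 * a * b) := by linarith [neg_abs_le u]
    generalize √(u ^ 2 + 4 * a * b) = r at hsq hpos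
    refine ⟨(u + r) / (2 * a), by simp only [Set.mem_Ioi]; positivity, ?_⟩
    change a * ((u + r) / (2 * a)) - b / ((u + r) / (2 * a)) = u
    rw [sub_eq_iff_eq_add, div_div_eq_mul_div, ← sub_eq_iff_eq_add', eq_div_iff hpos.ne']
    field_simp
    linarith
  have habs : ∀ s ∈ Set.Ioi (0 : ℝ), |a + b / s ^ 2| • rexp (-(1 / 2) * (a * s - b / s) ^ 2)
      = a * h s + b / s ^ 2 * h s := by
    intro s hs
    rw [abs_of_pos (by positivity), smul_eq_mul, add_mul]
  have hInt : IntegrableOn (fun s ↦ a * h s + b / s ^ 2 * h s) (Set.Ioi 0) := by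
    rw [← integrableOn_congr_fun habs measurableSet_Ioi,
      ← integrableOn_image_iff_integrableOn_abs_deriv_smul measurableSet_Ioi hder hinj
        (fun u ↦ rexp (-(1 / 2) * u ^ 2)), himg, integrableOn_univ]
    exact integrable_exp_neg_mul_sq (by norm_num)
  have hmeas : Measurable h := by fun_prop
  have hIntA : IntegrableOn (fun s ↦ a * h s) (Set.Ioi 0) := by
    refine hInt.mono' (by fun_prop) ?_
    refine (ae_restrict_iff' measurableSet_Ioi).mpr (.of_forall fun s hs ↦ ?_)
    rw [Real.norm_of_nonneg (by positivity)]
    exact le_add_of_nonneg_right (by positivity)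
  have hIntB : IntegrableOn (fun s ↦ b / s ^ 2 * h s) (Set.Ioi 0) := by
    refine (hInt.sub hIntA).congr_fun (fun s _ ↦ ?_) measurableSet_Ioi
    exact add_sub_cancel_left _ _
  have htotal : ∫ s in Set.Ioi (0 : ℝ), (a * h s + b / s ^ 2 * h s) = √(2 * π) := by
    rw [← setIntegral_congr_fun measurableSet_Ioi habs,
      ← integral_image_eq_integral_abs_deriv_smul measurableSet_Ioi hder hinj
        (fun u ↦ rexp (-(1 / 2) * u ^ 2)), himg, setIntegral_univ, integral_gaussian]
    congr 1
    ring
  have hswap : ∫ s in Set.Ioi (0 : ℝ), b / s ^ 2 * h s = ∫ s in Set.Ioi (0 : ℝ), a * h s := by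
    have hd : ∀ s ∈ Set.Ioi (0 : ℝ), HasDerivWithinAt (fun s : ℝ ↦ b / a * s⁻¹)
        (b / a * -(s ^ 2)⁻¹) (Set.Ioi 0) s := fun s hs ↦
      ((hasDerivAt_inv (Set.mem_Ioi.mp hs).ne').const_mul (b / a)).hasDerivWithinAt
    have hi : Set.InjOn (fun s : ℝ ↦ b / a * s⁻¹) (Set.Ioi 0) := fun x _ y _ hxy ↦
      inv_injective (mul_left_cancel₀ (by positivity) hxy)
    have him : (fun s : ℝ ↦ b / a * s⁻¹) '' Set.Ioi 0 = Set.Ioi 0 := by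
      ext u
      constructor
      · rintro ⟨s, hs, rfl⟩
        have : 0 < s := hs
        simp only [Set.mem_Ioi]
        positivity
      · intro hu
        have : 0 < u := hu
        refine ⟨b / a * u⁻¹, by simp only [Set.mem_Ioi]; positivity, ?_⟩
        simp only
        field_simp
    have := integral_image_eq_integral_abs_deriv_smul measurableSet_Ioi hd hi (fun s ↦ a * h s)
    rw [him] at this
    rw [this]
    refine setIntegral_congr_fun measurableSet_Ioi fun s hs ↦ ?_
    have hs' : 0 < s := hs
    have h1 : h (b / a * s⁻¹) = h s := by
      simp only [hdef]
      congr 2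
      rw [← neg_sq]
      congr 1
      field_simp
      ring
    simp only [h1, smul_eq_mul, mul_neg, abs_neg]
    rw [abs_of_pos (by positivity)]
    field_simp
  rw [integral_add hIntA hIntB, hswap, integral_const_mul] at htotal
  rw [eq_div_iff (by positivity)]
  linarith

/-- The Laplace-type integral behind the representation of the Laplace density as a Gaussian
scale mixture. -/
theorem integral_rpow_neg_half_mul_exp_Ioi {a b : ℝ} (ha : 0 < a) (hb : 0 ≤ b) :
    ∫ v in Set.Ioi (0 : ℝ), v ^ (-(1 / 2) : ℝ) * rexp (-(a ^ 2 * v / 2) - b ^ 2 / (2 * v))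
      = √(2 * π) / a * rexp (-(a * b)) := by
  have key : ∫ s in Set.Ioi (0 : ℝ), rexp (-(1 / 2) * (a * s - b / s) ^ 2)
      = √(2 * π) / (2 * a) := by
    rcases hb.eq_or_lt with rfl | hb
    · have (s : ℝ) : -(1 / 2) * (a * s - 0 / s) ^ 2 = -(a ^ 2 / 2) * s ^ 2 := by ring
      simp_rw [this]
      rw [integral_gaussian_Ioi, show π / (a ^ 2 / 2) = 2 * π / a ^ 2 by field_simp,
        Real.sqrt_div (by positivity), Real.sqrt_sq ha.le]
      ring
    · exact integral_exp_neg_sq_sub_inv_Ioi ha hb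
  rw [← integral_comp_rpow_Ioi_of_pos (p := 2) two_pos]
  calc _ = ∫ s in Set.Ioi (0 : ℝ),
        2 * rexp (-(a * b)) * rexp (-(1 / 2) * (a * s - b / s) ^ 2) := by
        refine setIntegral_congr_fun measurableSet_Ioi fun s hs ↦ ?_
        have hs' : 0 < s := hs
        simp only [smul_eq_mul]
        rw [← Real.rpow_mul hs'.le, show (2 : ℝ) * -(1 / 2) = -1 by norm_num,
          show (2 : ℝ) - 1 = 1 by norm_num, Real.rpow_one, Real.rpow_neg_one, Real.rpow_two,
          mul_assoc 2 (rexp _), ← Real.exp_add]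
        rw [show -(a * b) + -(1 / 2) * (a * s - b / s) ^ 2
          = -(a ^ 2 * s ^ 2 / 2) - b ^ 2 / (2 * s ^ 2) by field_simp; ring]
        field_simp
    _ = _ := by
        rw [integral_const_mul, key]
        field_simp

/-- The Laplace transform of `v ^ (a - 1)` on the right half-plane. -/
theorem integral_rpow_mul_cexp_neg_mul_Ioi {a : ℝ} (ha : 0 < a) {r : ℂ} (hr : 0 < r.re) :
    ∫ v in Set.Ioi (0 : ℝ), ((v ^ (a - 1) : ℝ) : ℂ) * cexp (-(r * v))
      = Real.Gamma a * r ^ (-a : ℂ) := by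
  have hopen : IsOpen {z : ℂ | 0 < z.re} := isOpen_lt continuous_const continuous_re
  have hInt {b c : ℝ} (hb : 0 < b) (hc : -1 < c) :
      IntegrableOn (fun v : ℝ ↦ v ^ c * rexp (-(b * v))) (Set.Ioi 0) := by
    simpa [neg_mul] using integrableOn_rpow_mul_exp_neg_mul_rpow hc one_pos hb
  have hmeas (c : ℝ) (z : ℂ) : AEStronglyMeasurable
      (fun v : ℝ ↦ ((v ^ c : ℝ) : ℂ) * cexp (-(z * v))) (volume.restrict (Set.Ioi 0)) :=
    Measurable.aestronglyMeasurable (by fun_prop)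
  have hnorm (c : ℝ) (z : ℂ) {v : ℝ} (hv : 0 < v) :
      ‖((v ^ c : ℝ) : ℂ) * cexp (-(z * v))‖ = v ^ c * rexp (-(z.re * v)) := by
    rw [norm_mul, Complex.norm_real, Real.norm_of_nonneg (by positivity), Complex.norm_exp]
    simp
  have hf : DifferentiableOn ℂ
      (fun z : ℂ ↦ ∫ v in Set.Ioi (0 : ℝ), ((v ^ (a - 1) : ℝ) : ℂ) * cexp (-(z * v)))
      {z | 0 < z.re} := by
    intro z hz
    have hz' : 0 < z.re := hz
    refine (hasDerivAt_integral_of_dominated_loc_of_deriv_le (s := {x : ℂ | z.re / 2 < x.re})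
      (F' := fun x v ↦ ((v ^ (a - 1) : ℝ) : ℂ) * (cexp (-(x * v)) * -v))
      (bound := fun v ↦ v ^ a * rexp (-(z.re / 2 * v))) ?_ (.of_forall (hmeas _)) ?_ ?_ ?_
      (hInt (half_pos hz') (by linarith)) ?_).2.differentiableAt.differentiableWithinAt
    · exact (isOpen_lt continuous_const continuous_re).mem_nhds (half_lt_self hz')
    · refine (hInt (c := a - 1) hz' (by linarith)).mono' (hmeas _ z) ?_
      exact (ae_restrict_iff' measurableSet_Ioi).mpr (.of_forall fun v hv ↦ (hnorm _ _ hv).le)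
    · exact Measurable.aestronglyMeasurable (by fun_prop)
    · refine (ae_restrict_iff' measurableSet_Ioi).mpr (.of_forall fun v hv x hx ↦ ?_)
      have hv' : 0 < v := hv
      have hx' : z.re / 2 < x.re := hx
      rw [← mul_assoc, norm_mul, hnorm _ _ hv, norm_neg, Complex.norm_real,
        Real.norm_of_nonneg hv'.le, mul_right_comm, ← Real.rpow_add_one hv'.ne', sub_add_cancel]
      gcongr
    · refine .of_forall fun v x _ ↦ ?_
      have h := ((hasDerivAt_id x).mul_const (v : ℂ)).neg.cexp.const_mul (((v ^ (a - 1) : ℝ) : ℂ))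
      rwa [one_mul] at h
  have hg : DifferentiableOn ℂ (fun z : ℂ ↦ (Real.Gamma a : ℂ) * z ^ (-a : ℂ)) {z | 0 < z.re} :=
    fun z hz ↦ ((differentiableAt_id.cpow_const (Or.inl hz)).const_mul _).differentiableWithinAt
  have heq {x : ℝ} (hx : 0 < x) :
      ∫ v in Set.Ioi (0 : ℝ), ((v ^ (a - 1) : ℝ) : ℂ) * cexp (-((x : ℂ) * v))
        = Real.Gamma a * (x : ℂ) ^ (-a : ℂ) := by
    have h := congrArg ((↑) : ℝ → ℂ) (integral_rpow_mul_exp_neg_mul_Ioi ha hx)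
    rw [← integral_complex_ofReal, one_div, Real.inv_rpow hx.le, ← Real.rpow_neg hx.le,
      mul_comm, ofReal_mul, ofReal_cpow hx.le, ofReal_neg] at h
    simpa using h
  have hfreq : ∃ᶠ z in nhdsWithin (1 : ℂ) {1}ᶜ,
      ∫ v in Set.Ioi (0 : ℝ), ((v ^ (a - 1) : ℝ) : ℂ) * cexp (-(z * v))
        = Real.Gamma a * z ^ (-a : ℂ) := by
    have htend : Filter.Tendsto ((↑) : ℝ → ℂ) (nhdsWithin 1 {1}ᶜ) (nhdsWithin (1 : ℂ) {1}ᶜ) := by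
      refine tendsto_nhdsWithin_iff.mpr ⟨?_, ?_⟩
      · exact (continuous_ofReal.tendsto' 1 1 ofReal_one).mono_left nhdsWithin_le_nhds
      · filter_upwards [self_mem_nhdsWithin] with x hx
        simpa using hx
    refine htend.frequently (Filter.Eventually.frequently ?_)
    filter_upwards [nhdsWithin_le_nhds (Ioi_mem_nhds (zero_lt_one' ℝ))] with x hx
    exact heq hx
  exact (hf.analyticOnNhd hopen).eqOn_of_preconnected_of_frequently_eq (hg.analyticOnNhd hopen)
    (convex_halfSpace_re_gt 0).isPreconnected (by simp) hfreq hr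

/-- The Gaussian integral with covariance `v • 1` and a complex linear term. -/
theorem integral_cexp_neg_inv_mul_sum_add {ι : Type*} [Fintype ι] {v : ℝ} (hv : 0 < v)
    (c : ι → ℂ) :
    ∫ z : ι → ℝ, cexp (-((1 / (2 * v) : ℝ) : ℂ) * ∑ i, (z i : ℂ) ^ 2 + ∑ i, c i * z i)
      = ((2 * π * v) ^ (Fintype.card ι / 2 : ℝ) : ℝ) * cexp (v / 2 * ∑ i, c i ^ 2) := by
  rw [GaussianFourier.integral_cexp_neg_mul_sum_add (by rw [ofReal_re]; positivity)]
  have hv' : (v : ℂ) ≠ 0 := by exact_mod_cast hv.ne'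
  congr 1
  · rw [ofReal_cpow (by positivity)]
    push_cast
    congr 1
    field_simp
  · congr 1
    push_cast
    field_simp
    ring

/-- The complex Laplace transform of the function `exp (-√(1 + |γ|²) |z|)`, at `γ + i t`. -/
theorem integral_cexp_mul_exp_neg_sqrt {ι : Type*} [Fintype ι] (γ t : ι → ℝ) :
    ∫ z : ι → ℝ, cexp (∑ i, ((γ i : ℂ) + I * t i) * z i) *
        rexp (-√(1 + γ ⬝ᵥ γ) * √(z ⬝ᵥ z))
      = ((2 : ℝ) ^ (Fintype.card ι) * π ^ (((Fintype.card ι : ℝ) - 1) / 2) * √(1 + γ ⬝ᵥ γ) *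
          Real.Gamma (((Fintype.card ι : ℝ) + 1) / 2) : ℝ) *
        (((1 + t ⬝ᵥ t : ℝ) : ℂ) - 2 * I * ((t ⬝ᵥ γ : ℝ) : ℂ)) ^
          (-(((Fintype.card ι : ℂ) + 1) / 2)) := by
  have hγ : 0 ≤ γ ⬝ᵥ γ := dotProduct_self_star_nonneg γ
  have ht : 0 ≤ t ⬝ᵥ t := dotProduct_self_star_nonneg t
  set n : ℕ := Fintype.card ι
  set α : ℝ := √(1 + γ ⬝ᵥ γ)
  have hα : 0 < α := Real.sqrt_pos.mpr (by linarith)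
  have hα2 : α ^ 2 = 1 + γ ⬝ᵥ γ := Real.sq_sqrt (by linarith)
  set w : ℂ := ((1 + t ⬝ᵥ t : ℝ) : ℂ) - 2 * I * ((t ⬝ᵥ γ : ℝ) : ℂ) with hw
  have hwre : w.re = 1 + t ⬝ᵥ t := by simp [hw]
  let K (c : ι → ℂ) (z : ι → ℝ) (v : ℝ) : ℂ :=
    ((v ^ (-(1 / 2) : ℝ) * rexp (-(α ^ 2 * v / 2)) : ℝ) : ℂ) *
      cexp (-((1 / (2 * v) : ℝ) : ℂ) * ∑ i, (z i : ℂ) ^ 2 + ∑ i, c i * z i)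
  have hz (c : ι → ℂ) {v : ℝ} (hv : 0 < v) : ∫ z, K c z v =
      ((2 * π) ^ (n / 2 : ℝ) : ℝ) * ((v ^ (((n : ℝ) + 1) / 2 - 1) : ℝ) *
        cexp (-((α ^ 2 - ∑ i, c i ^ 2) / 2 * v))) := by
    simp only [K]
    rw [integral_const_mul, integral_cexp_neg_inv_mul_sum_add hv,
      Real.mul_rpow (by positivity) hv.le,
      show ((n : ℝ) + 1) / 2 - 1 = -(1 / 2) + n / 2 by ring, Real.rpow_add hv,
      show -((α ^ 2 - ∑ i, c i ^ 2) / 2 * (v : ℂ))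
        = ((-(α ^ 2 * v / 2) : ℝ) : ℂ) + v / 2 * ∑ i, c i ^ 2 by push_cast; ring,
      Complex.exp_add]
    push_cast
    ring
  have hnorm (z : ι → ℝ) {v : ℝ} (hv : 0 < v) :
      ((‖K (fun i ↦ (γ i : ℂ) + I * t i) z v‖ : ℝ) : ℂ) = K (fun i ↦ (γ i : ℂ)) z v := by
    simp only [K]
    rw [norm_mul, Complex.norm_real, Real.norm_of_nonneg (by positivity), Complex.norm_exp]
    have hre : (-((1 / (2 * v) : ℝ) : ℂ) * ∑ i, (z i : ℂ) ^ 2 +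
        ∑ i, ((γ i : ℂ) + I * t i) * z i).re
          = -(1 / (2 * v)) * ∑ i, z i ^ 2 + ∑ i, γ i * z i := by
      rw [add_re, ← ofReal_neg, re_ofReal_mul, re_sum, re_sum]
      simp [← ofReal_pow]
    rw [hre]
    push_cast
    rfl
  have hsqγ : ∑ i, (γ i : ℂ) ^ 2 = ((γ ⬝ᵥ γ : ℝ) : ℂ) := by
    simp [dotProduct, sq]
  have hsq : (α : ℂ) ^ 2 - ∑ i, ((γ i : ℂ) + I * t i) ^ 2 = w := by
    rw [← ofReal_pow, hα2, hw]
    simp only [dotProduct, add_sq, mul_pow, I_sq, Finset.sum_add_distrib]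
    push_cast
    simp only [Finset.mul_sum, ← sq, neg_mul, one_mul, Finset.sum_neg_distrib]
    rw [show ∑ i, 2 * (γ i : ℂ) * (I * t i) = ∑ i, 2 * I * (t i * γ i) from
      Finset.sum_congr rfl fun i _ ↦ by ring]
    ring
  have hvint (z : ι → ℝ) : ∫ v in Set.Ioi (0 : ℝ), K (fun i ↦ (γ i : ℂ) + I * t i) z v =
      (√(2 * π) / α : ℝ) * (cexp (∑ i, ((γ i : ℂ) + I * t i) * z i) *
        rexp (-α * √(z ⬝ᵥ z))) := by
    have h1 := integral_rpow_neg_half_mul_exp_Ioi hα (Real.sqrt_nonneg (z ⬝ᵥ z))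
    have hzz : 0 ≤ z ⬝ᵥ z := dotProduct_self_star_nonneg z
    rw [Real.sq_sqrt hzz] at h1
    rw [show (√(2 * π) / α : ℝ) * (cexp (∑ i, ((γ i : ℂ) + I * t i) * z i) *
        rexp (-α * √(z ⬝ᵥ z))) = ((√(2 * π) / α * rexp (-(α * √(z ⬝ᵥ z))) : ℝ) : ℂ) *
        cexp (∑ i, ((γ i : ℂ) + I * t i) * z i) by rw [neg_mul]; push_cast; ring,
      ← h1, ← integral_complex_ofReal, ← integral_mul_const]
    refine setIntegral_congr_fun measurableSet_Ioi fun v _ ↦ ?_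
    simp only [K, Complex.exp_add, ← mul_assoc]
    congr 1
    rw [sub_eq_add_neg, Real.exp_add]
    simp only [dotProduct]
    push_cast
    rw [← mul_assoc]
    congr 2
    simp only [← sq]
    ring
  have hInt : Integrable (Function.uncurry (K fun i ↦ (γ i : ℂ) + I * t i))
      ((volume : Measure (ι → ℝ)).prod (volume.restrict (Set.Ioi (0 : ℝ)))) := by
    rw [integrable_prod_iff' (Measurable.aestronglyMeasurable (by
      simp only [K, Function.uncurry_def]; fun_prop))]
    constructor
    · refine (ae_restrict_iff' measurableSet_Ioi).mpr (.of_forall fun v hv ↦ ?_)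
      have hv' : 0 < v := hv
      have hb : 0 < (((1 / (2 * v) : ℝ) : ℂ)).re := by rw [ofReal_re]; positivity
      simp only [K, Function.uncurry_apply_pair]
      exact (GaussianFourier.integrable_cexp_neg_mul_sum_add hb
        fun i ↦ (γ i : ℂ) + I * t i).const_mul _
    · have h2 : IntegrableOn (fun v : ℝ ↦ (2 * π) ^ (n / 2 : ℝ) *
          (v ^ (((n : ℝ) + 1) / 2 - 1) * rexp (-(1 / 2) * v ^ (1 : ℝ)))) (Set.Ioi 0) :=
        (integrableOn_rpow_mul_exp_neg_mul_rpow (by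
          have : (0 : ℝ) ≤ n := n.cast_nonneg
          linarith) one_pos (by norm_num)).const_mul _
      refine h2.congr_fun (fun v hv ↦ ofReal_injective ?_) measurableSet_Ioi
      simp only [Function.uncurry_apply_pair]
      rw [← integral_complex_ofReal, integral_congr_ae (.of_forall fun z ↦ hnorm z hv), hz _ hv, hsqγ,
        ← ofReal_pow, hα2]
      push_cast
      rw [Real.rpow_one]
      congr 3
      ring
  have hswap := integral_integral_swap hInt
  rw [integral_congr_ae (.of_forall hvint), integral_const_mul,
    setIntegral_congr_fun measurableSet_Ioi (fun v hv ↦ hz _ hv), hsq, integral_const_mul] at hswap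
  have hn0 : (0 : ℝ) ≤ n := n.cast_nonneg
  have hw2 : 0 < (w / 2).re := by rw [div_ofNat_re, hwre]; linarith
  have hfac : (w / 2) ^ (-((((n : ℝ) + 1) / 2 : ℝ) : ℂ)) =
      ((2 ^ (((n : ℝ) + 1) / 2) : ℝ) : ℂ) * w ^ (-(((n : ℂ) + 1) / 2)) := by
    have hw0 : w ≠ 0 := fun h ↦ by simp [h] at hw2
    rw [show w / 2 = ((2⁻¹ : ℝ) : ℂ) * w by push_cast; ring,
      cpow_def_of_ne_zero (mul_ne_zero (by norm_num) hw0), log_ofReal_mul (by norm_num) hw0,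
      add_mul, Complex.exp_add, cpow_def_of_ne_zero hw0, Real.rpow_def_of_pos two_pos, Real.log_inv]
    push_cast
    rw [neg_mul_neg]
  rw [integral_rpow_mul_cexp_neg_mul_Ioi (by linarith) hw2, hfac] at hswap
  have hconst : (2 * π) ^ ((n : ℝ) / 2) * 2 ^ (((n : ℝ) + 1) / 2) =
      √(2 * π) * (2 ^ n * π ^ (((n : ℝ) - 1) / 2)) := by
    rw [Real.sqrt_eq_rpow, Real.mul_rpow two_pos.le pi_pos.le, Real.mul_rpow two_pos.le pi_pos.le,
      ← Real.rpow_natCast]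
    have h2 : (2 : ℝ) ^ ((n : ℝ) / 2) * 2 ^ (((n : ℝ) + 1) / 2) =
        2 ^ (1 / 2 : ℝ) * 2 ^ (n : ℝ) := by
      rw [← Real.rpow_add two_pos, ← Real.rpow_add two_pos]
      congr 1
      ring
    have h3 : π ^ ((n : ℝ) / 2) = π ^ (1 / 2 : ℝ) * π ^ (((n : ℝ) - 1) / 2) := by
      rw [← Real.rpow_add pi_pos]
      congr 1
      ring
    rw [h3, mul_right_comm, h2]
    ring
  have hne : ((√(2 * π) / α : ℝ) : ℂ) ≠ 0 := ofReal_ne_zero.mpr (by positivity)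
  refine mul_left_cancel₀ hne (hswap.trans ?_)
  have hcast := congrArg ((↑) : ℝ → ℂ) hconst
  have hα0 : (α : ℂ) ≠ 0 := ofReal_ne_zero.mpr hα.ne'
  rw [ofReal_mul, ofReal_mul] at hcast
  rw [mul_left_comm (Real.Gamma _ : ℂ), ← mul_assoc, hcast]
  simp only [ofReal_mul, ofReal_div]
  field_simp

/-- Change of variables `y = μ + A z` in an integral over `ι → ℝ`. -/
theorem integral_comp_add_mulVec {ι E : Type*} [Fintype ι] [DecidableEq ι]
    [NormedAddCommGroup E] [NormedSpace ℝ E] (μ : ι → ℝ) {A : Matrix ι ι ℝ} (hA : IsUnit A)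
    (f : (ι → ℝ) → E) : ∫ y, f y = ∫ z, |A.det| • f (μ + A *ᵥ z) := by
  have hder (z : ι → ℝ) (_ : z ∈ Set.univ) : HasFDerivWithinAt (fun z ↦ μ + A *ᵥ z)
      (LinearMap.toContinuousLinearMap A.toLin') Set.univ z :=
    ((LinearMap.toContinuousLinearMap A.toLin').hasFDerivAt.const_add μ).hasFDerivWithinAt
  have hbij : Function.Bijective fun z ↦ μ + A *ᵥ z :=
    (AddGroup.addLeft_bijective μ).comp
      ⟨Matrix.mulVec_injective_iff_isUnit.mpr hA, Matrix.mulVec_surjective_iff_isUnit.mpr hA⟩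
  have h := integral_image_eq_integral_abs_det_fderiv_smul volume MeasurableSet.univ hder
    hbij.injective.injOn f
  rw [Set.image_univ, hbij.surjective.range_eq, setIntegral_univ, setIntegral_univ] at h
  simpa [ContinuousLinearMap.det] using h

theorem Matrix.PosDef.exists_isUnit_mul_transpose {ι : Type*} [Fintype ι] [DecidableEq ι]
    {S : Matrix ι ι ℝ} (hS : S.PosDef) : ∃ A : Matrix ι ι ℝ, IsUnit A ∧ S = A * Aᵀ := by
  open scoped MatrixOrder in
  obtain ⟨B, hB, rfl⟩ := CStarAlgebra.isStrictlyPositive_iff_eq_star_mul_self.mp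
    hS.isStrictlyPositive
  refine ⟨Bᵀ, by simpa [Matrix.isUnit_iff_isUnit_det] using hB, ?_⟩
  rw [transpose_transpose, star_eq_conjTranspose, conjTranspose_eq_transpose_of_trivial]

/-- Proposition 1: the characteristic function of the multivariate skew Laplace
distribution `MSL_p(μ, Σ, γ)`. -/
theorem msl_characteristic_function
    (p : ℕ) (hp : 1 ≤ p) (μ γ : Fin p → ℝ)
    (S : Matrix (Fin p) (Fin p) ℝ) (hS : S.PosDef) (t : Fin p → ℝ) :
    ∫ y : Fin p → ℝ,
      Complex.exp (Complex.I * ((t ⬝ᵥ y : ℝ) : ℂ)) *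
      ((S.det ^ (-(1:ℝ)/2) /
          ((2:ℝ) ^ p * π ^ (((p:ℝ) - 1)/2) *
            Real.sqrt (1 + γ ⬝ᵥ S⁻¹ *ᵥ γ) * Real.Gamma (((p:ℝ) + 1)/2)) *
        Real.exp (-(Real.sqrt (1 + γ ⬝ᵥ S⁻¹ *ᵥ γ)) *
            Real.sqrt ((y - μ) ⬝ᵥ S⁻¹ *ᵥ (y - μ)) +
          (y - μ) ⬝ᵥ S⁻¹ *ᵥ γ) : ℝ) : ℂ)
    = Complex.exp (Complex.I * ((t ⬝ᵥ μ : ℝ) : ℂ)) *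
      (((1 + t ⬝ᵥ S *ᵥ t : ℝ) : ℂ) - 2 * Complex.I * ((t ⬝ᵥ γ : ℝ) : ℂ))
        ^ (-(((p : ℂ) + 1)/2)) := by
  obtain ⟨A, hA, hSA⟩ := hS.exists_isUnit_mul_transpose
  have hdet : IsUnit A.det := (Matrix.isUnit_iff_isUnit_det A).mp hA
  set η : Fin p → ℝ := A⁻¹ *ᵥ γ with hη
  have hγ : γ = A *ᵥ η := by
    rw [hη, mulVec_mulVec, Matrix.mul_nonsing_inv _ hdet, one_mulVec]
  have hquad (x y : Fin p → ℝ) : (A *ᵥ x) ⬝ᵥ S⁻¹ *ᵥ (A *ᵥ y) = x ⬝ᵥ y := by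
    rw [hSA, Matrix.mul_inv_rev, mulVec_mulVec, Matrix.mul_assoc, Matrix.nonsing_inv_mul _ hdet,
      Matrix.mul_one, ← transpose_nonsing_inv, mulVec_transpose, dotProduct_comm,
      ← dotProduct_mulVec, mulVec_mulVec, Matrix.nonsing_inv_mul _ hdet, one_mulVec,
      dotProduct_comm]
  have htS : t ⬝ᵥ S *ᵥ t = (Aᵀ *ᵥ t) ⬝ᵥ (Aᵀ *ᵥ t) := by
    rw [hSA, ← mulVec_mulVec, dotProduct_mulVec, mulVec_transpose]
  have htA (x : Fin p → ℝ) : t ⬝ᵥ A *ᵥ x = (Aᵀ *ᵥ t) ⬝ᵥ x := by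
    rw [dotProduct_mulVec, mulVec_transpose]
  have hdetpos : 0 < |A.det| := abs_pos.mpr hdet.ne_zero
  have hdetS : S.det ^ (-(1 : ℝ) / 2) = |A.det|⁻¹ := by
    rw [hSA, det_mul, det_transpose, ← sq, ← sq_abs, ← Real.rpow_natCast,
      ← Real.rpow_mul hdetpos.le, ← Real.rpow_neg_one]
    norm_num
  rw [integral_comp_add_mulVec μ hA]
  simp only [add_sub_cancel_left, hγ, hquad, htS, htA, dotProduct_add]
  have hmain := integral_cexp_mul_exp_neg_sqrt η (Aᵀ *ᵥ t)
  rw [Fintype.card_fin] at hmain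
  set C : ℝ := (2 : ℝ) ^ p * π ^ (((p : ℝ) - 1) / 2) * √(1 + η ⬝ᵥ η) *
    Real.Gamma (((p : ℝ) + 1) / 2) with hC
  have hC0 : 0 < C := by
    have : 0 ≤ η ⬝ᵥ η := dotProduct_self_star_nonneg η
    have : 0 < Real.Gamma (((p : ℝ) + 1) / 2) := Real.Gamma_pos_of_pos (by positivity)
    positivity
  have hC0' : (C : ℂ) ≠ 0 := ofReal_ne_zero.mpr hC0.ne'
  have hd0 : ((|A.det| : ℝ) : ℂ) ≠ 0 := ofReal_ne_zero.mpr hdetpos.ne'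
  calc _ = ∫ z : Fin p → ℝ, cexp (I * ((t ⬝ᵥ μ : ℝ) : ℂ)) * (C : ℂ)⁻¹ *
        (cexp (∑ i, ((η i : ℂ) + I * ((Aᵀ *ᵥ t) i : ℝ)) * z i) *
          rexp (-√(1 + η ⬝ᵥ η) * √(z ⬝ᵥ z))) := by
        refine integral_congr_ae (.of_forall fun z ↦ ?_)
        have hsum : ∑ i, ((η i : ℂ) + I * ((Aᵀ *ᵥ t) i : ℝ)) * z i =
            ((z ⬝ᵥ η : ℝ) : ℂ) + I * (((Aᵀ *ᵥ t) ⬝ᵥ z : ℝ) : ℂ) := by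
          simp only [dotProduct, ofReal_sum, ofReal_mul, Finset.mul_sum,
            ← Finset.sum_add_distrib]
          exact Finset.sum_congr rfl fun i _ ↦ by ring
        simp only [hdetS, real_smul]
        rw [hsum, Real.exp_add, ofReal_add, mul_add, Complex.exp_add, Complex.exp_add]
        simp only [ofReal_mul, ofReal_div, ofReal_inv, ofReal_exp (z ⬝ᵥ η)]
        field_simp
    _ = _ := by
        rw [integral_const_mul, hmain, mul_assoc, inv_mul_cancel_left₀ hC0']
end

section
/- The covariance matrix of the MSL_p(μ, Σ, γ) distribution is (p+1)(Σ + 2γγᵀ): for every integer p ≥ 1, every μ, γ ∈ ℝ^p and every symmetric positive definite p×p real matrix Σ, writing m = μ + (p+1)γ for the mean, one has for all indices 1 ≤ k, l ≤ p that ∫_{ℝ^p} (y_k − m_k)(y_l − m_l) · f_MSL(y) dy = (p+1)·(Σ_{kl} + 2·γ_k·γ_l). -/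
open MeasureTheory Real Matrix

lemma integral_exp_neg_sq_half : ∫ t : ℝ, exp (-t ^ 2 / 2) = √(2 * π) := by
  have := integral_gaussian (1 / 2)
  rw [show π / (1 / 2) = 2 * π by ring] at this
  rw [← this]
  congr 1; ext u; congr 1; ring

lemma integrableOn_exp_neg_sq_sub_div {a r : ℝ} (ha : 0 < a) :
    IntegrableOn (fun t : ℝ => exp (-(a * t - r / t) ^ 2 / 2)) (Set.Ioi 0) := by
  have h1 : Integrable (fun t : ℝ => exp (a * r) * exp (-(a ^ 2 / 2) * t ^ 2)) :=
    (integrable_exp_neg_mul_sq (by positivity)).const_mul _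
  refine h1.integrableOn.mono' (by fun_prop) ?_
  refine (ae_restrict_iff' measurableSet_Ioi).2 (.of_forall fun t ht => ?_)
  have ht : 0 < t := ht
  rw [norm_of_nonneg (exp_pos _).le, ← exp_add, exp_le_exp]
  have h2 : (a * t - r / t) ^ 2 = a ^ 2 * t ^ 2 - 2 * (a * r) + (r / t) ^ 2 := by
    field_simp; ring
  rw [h2]
  nlinarith [sq_nonneg (r / t)]

/-- An instance of the Cauchy–Schlömilch transformation. -/
lemma integral_exp_neg_sq_sub_div {a r : ℝ} (ha : 0 < a) (hr : 0 < r) :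
    ∫ t in Set.Ioi (0 : ℝ), exp (-(a * t - r / t) ^ 2 / 2) = √(2 * π) / (2 * a) := by
  set h : ℝ → ℝ := fun t => exp (-(a * t - r / t) ^ 2 / 2) with hh
  have hint : IntegrableOn h (Set.Ioi 0) := integrableOn_exp_neg_sq_sub_div ha
  have hdiv : ∀ c : ℝ, ∀ t ∈ Set.Ioi (0 : ℝ),
      HasDerivWithinAt (fun t => c / t) (-(c / t ^ 2)) (Set.Ioi 0) t := by
    intro c t ht
    have ht : t ≠ 0 := ne_of_gt ht
    have := ((hasDerivAt_inv ht).const_mul c).hasDerivWithinAt (s := Set.Ioi 0)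
    simpa [div_eq_mul_inv] using this
  have hψinj : Set.InjOn (fun t : ℝ => r / a / t) (Set.Ioi 0) := by
    intro s hs t ht hst
    have hs : 0 < s := hs
    have ht : 0 < t := ht
    simp only at hst
    field_simp at hst
    exact hst.symm
  have hψim : (fun t : ℝ => r / a / t) '' Set.Ioi 0 = Set.Ioi 0 := by
    ext s
    constructor
    · rintro ⟨t, ht, rfl⟩
      have ht : 0 < t := ht
      exact Set.mem_Ioi.2 (by positivity)
    · intro hs
      have hs : 0 < s := hs
      exact ⟨r / a / s, Set.mem_Ioi.2 (by positivity), by simp only; field_simp⟩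
  have hcongr : Set.EqOn (fun t => |-(r / a / t ^ 2)| • h (r / a / t))
      (fun t => a⁻¹ * (r / t ^ 2 * h t)) (Set.Ioi 0) := by
    intro t ht
    have ht : 0 < t := ht
    have e : (a * (r / a / t) - r / (r / a / t)) ^ 2 = (a * t - r / t) ^ 2 := by
      field_simp; ring
    simp only [hh, e, abs_neg, smul_eq_mul]
    rw [abs_of_pos (by positivity)]
    field_simp
  have hI : ∫ t in Set.Ioi (0 : ℝ), r / t ^ 2 * h t = a * ∫ t in Set.Ioi (0 : ℝ), h t := by
    have := integral_image_eq_integral_abs_deriv_smul measurableSet_Ioi (hdiv (r / a)) hψinj h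
    rw [hψim, setIntegral_congr_fun measurableSet_Ioi hcongr, integral_const_mul] at this
    rw [this]; field_simp
  have hint' : IntegrableOn (fun t => r / t ^ 2 * h t) (Set.Ioi 0) := by
    have := (integrableOn_image_iff_integrableOn_abs_deriv_smul measurableSet_Ioi (hdiv (r / a)) hψinj h).1
      (by rwa [hψim])
    have := ((integrableOn_congr_fun hcongr measurableSet_Ioi).1 this).const_mul a
    refine this.congr (.of_forall fun t => ?_)
    simp only
    field_simp
  have hφ : ∀ t ∈ Set.Ioi (0 : ℝ),
      HasDerivWithinAt (fun t => a * t - r / t) (a + r / t ^ 2) (Set.Ioi 0) t := by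
    intro t ht
    have := ((hasDerivAt_id t).const_mul a).hasDerivWithinAt.fun_sub (hdiv r t ht)
    simpa using this
  have hφinj : Set.InjOn (fun t : ℝ => a * t - r / t) (Set.Ioi 0) := by
    intro s hs t ht hst
    have hs : 0 < s := hs
    have ht : 0 < t := ht
    simp only at hst
    have : (s - t) * (a * s * t + r) = 0 := by
      field_simp at hst
      linarith
    rcases mul_eq_zero.1 this with h0 | h0
    · linarith
    · have : 0 < a * s * t + r := by positivity
      linarith
  have hφim : (fun t : ℝ => a * t - r / t) '' Set.Ioi 0 = Set.univ := by
    refine Set.eq_univ_of_forall fun u => ?_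
    have hd : 0 < u ^ 2 + 4 * a * r := by positivity
    have hs : |u| < √(u ^ 2 + 4 * a * r) := by
      rw [← sqrt_sq_eq_abs]
      exact sqrt_lt_sqrt (sq_nonneg _) (by have : 0 < a * r := by positivity
                                           linarith)
    have hp : 0 < u + √(u ^ 2 + 4 * a * r) := by linarith [neg_abs_le u]
    refine ⟨(u + √(u ^ 2 + 4 * a * r)) / (2 * a), Set.mem_Ioi.2 (by positivity), ?_⟩
    have hq := sq_sqrt hd.le
    generalize √(u ^ 2 + 4 * a * r) = q at hq hp
    simp only
    field_simp
    linarith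
  have hJ := integral_image_eq_integral_abs_deriv_smul measurableSet_Ioi hφ hφinj
    (fun u => exp (-u ^ 2 / 2))
  have hcongr' : Set.EqOn (fun t => |a + r / t ^ 2| • exp (-(a * t - r / t) ^ 2 / 2))
      (fun t => a * h t + r / t ^ 2 * h t) (Set.Ioi 0) := by
    intro t ht
    have ht : 0 < t := ht
    simp only [hh, smul_eq_mul]
    rw [abs_of_pos (by positivity)]
    ring
  rw [hφim, setIntegral_congr_fun measurableSet_Ioi hcongr',
    integral_add (hint.const_mul a) hint', hI, integral_const_mul, setIntegral_univ] at hJ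
  rw [integral_exp_neg_sq_half] at hJ
  field_simp
  linarith

lemma integral_exp_neg_sq_add_sq_div {a r : ℝ} (ha : 0 < a) (hr : 0 ≤ r) :
    ∫ t in Set.Ioi (0 : ℝ), exp (-((a * t) ^ 2 + (r / t) ^ 2) / 2) =
      √(2 * π) / (2 * a) * exp (-(a * r)) := by
  rcases hr.eq_or_lt with rfl | hr
  · have := integral_gaussian_Ioi (a ^ 2 / 2)
    have e : √(π / (a ^ 2 / 2)) = √(2 * π) / a := by
      rw [show π / (a ^ 2 / 2) = 2 * π / a ^ 2 by field_simp, sqrt_div (by positivity),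
        sqrt_sq ha.le]
    rw [e] at this
    simp only [zero_div, mul_zero, neg_zero, exp_zero, mul_one]
    rw [show √(2 * π) / (2 * a) = √(2 * π) / a / 2 by field_simp, ← this]
    congr 1; ext t; congr 1; ring
  · rw [← integral_exp_neg_sq_sub_div ha hr, ← integral_mul_const]
    refine setIntegral_congr_fun measurableSet_Ioi fun t ht => ?_
    have ht : 0 < t := ht
    rw [← exp_add]
    congr 1
    field_simp
    ring

lemma integrable_pow_mul_exp_neg_sq_half (n : ℕ) :
    Integrable (fun t : ℝ => t ^ n * exp (-t ^ 2 / 2)) := by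
  have := integrable_rpow_mul_exp_neg_mul_sq (b := 1 / 2) (by norm_num) (s := n)
    (by have : (0 : ℝ) ≤ n := n.cast_nonneg
        linarith)
  refine this.congr (.of_forall fun t => ?_)
  simp only [rpow_natCast]
  congr 2; ring

lemma integral_pow_mul_exp_neg_sq_half (n : ℕ) :
    ∫ t in Set.Ioi (0 : ℝ), t ^ n * exp (-t ^ 2 / 2) =
      2 ^ (((n : ℝ) - 1) / 2) * Gamma (((n : ℝ) + 1) / 2) := by
  have := integral_rpow_mul_exp_neg_mul_rpow (p := 2) (q := n) (b := 1 / 2) (by norm_num)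
    (by have : (0 : ℝ) ≤ n := n.cast_nonneg
        linarith) (by norm_num)
  have e : (1 / 2 : ℝ) ^ (-((n : ℝ) + 1) / 2) * (1 / 2) = 2 ^ (((n : ℝ) - 1) / 2) := by
    rw [one_div, inv_rpow (by norm_num), ← rpow_neg (by norm_num), ← rpow_neg_one,
      ← rpow_add (by norm_num)]
    congr 1; ring
  rw [← e, ← this]
  congr 1; ext t
  rw [rpow_natCast, rpow_two]
  congr 2; ring

lemma integral_pow_add_two_mul_exp_neg_sq_half (n : ℕ) :
    ∫ t in Set.Ioi (0 : ℝ), t ^ (n + 2) * exp (-t ^ 2 / 2) =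
      (n + 1) * ∫ t in Set.Ioi (0 : ℝ), t ^ n * exp (-t ^ 2 / 2) := by
  have hn : (0 : ℝ) ≤ n := n.cast_nonneg
  rw [integral_pow_mul_exp_neg_sq_half, integral_pow_mul_exp_neg_sq_half]
  push_cast
  rw [show ((n : ℝ) + 2 + 1) / 2 = (n + 1) / 2 + 1 by ring, Gamma_add_one (by positivity),
    show ((n : ℝ) + 2 - 1) / 2 = (n - 1) / 2 + 1 by ring, rpow_add_one (by norm_num)]
  ring

section
variable {ι : Type*} [Fintype ι]

lemma exp_neg_dotProduct_self_half (z : ι → ℝ) :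
    exp (-(z ⬝ᵥ z) / 2) = ∏ k, exp (-z k ^ 2 / 2) := by
  rw [← exp_sum]
  congr 1
  rw [dotProduct, ← Finset.sum_neg_distrib, Finset.sum_div]
  exact Finset.sum_congr rfl fun k _ => by ring

lemma integral_mul_exp_neg_sq_half : ∫ t : ℝ, t * exp (-t ^ 2 / 2) = 0 := by
  have := integral_neg_eq_self (fun t : ℝ => t * exp (-t ^ 2 / 2)) volume
  simp only [neg_mul, neg_sq, integral_neg] at this
  linarith

lemma integral_sq_mul_exp_neg_sq_half : ∫ t : ℝ, t ^ 2 * exp (-t ^ 2 / 2) = √(2 * π) := by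
  have h := integral_pow_add_two_mul_exp_neg_sq_half 0
  have h1 := integral_comp_abs (f := fun t : ℝ => t ^ 2 * exp (-t ^ 2 / 2))
  have h2 := integral_comp_abs (f := fun t : ℝ => exp (-t ^ 2 / 2))
  simp only [sq_abs] at h1 h2
  rw [integral_exp_neg_sq_half] at h2
  simp at h
  rw [h1, h, ← h2]

lemma integrable_prod_pow_mul_exp_neg_dotProduct_self (m : ι → ℕ) :
    Integrable (fun z : ι → ℝ => (∏ k, z k ^ m k) * exp (-(z ⬝ᵥ z) / 2)) := by
  simp_rw [exp_neg_dotProduct_self_half, ← Finset.prod_mul_distrib]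
  exact Integrable.fintype_prod fun k => integrable_pow_mul_exp_neg_sq_half (m k)

lemma integral_prod_pow_mul_exp_neg_dotProduct_self (m : ι → ℕ) :
    ∫ z : ι → ℝ, (∏ k, z k ^ m k) * exp (-(z ⬝ᵥ z) / 2) =
      ∏ k, ∫ t : ℝ, t ^ m k * exp (-t ^ 2 / 2) := by
  simp_rw [exp_neg_dotProduct_self_half, ← Finset.prod_mul_distrib]
  exact integral_fintype_prod_volume_eq_prod (fun k (t : ℝ) => t ^ m k * exp (-t ^ 2 / 2))

lemma integral_exp_neg_dotProduct_self :
    ∫ z : ι → ℝ, exp (-(z ⬝ᵥ z) / 2) = √(2 * π) ^ Fintype.card ι := by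
  simpa [integral_exp_neg_sq_half] using integral_prod_pow_mul_exp_neg_dotProduct_self (ι := ι) 0

lemma integrable_exp_neg_dotProduct_self :
    Integrable fun z : ι → ℝ => exp (-(z ⬝ᵥ z) / 2) := by
  simpa using integrable_prod_pow_mul_exp_neg_dotProduct_self (ι := ι) 0

lemma integrable_apply_mul_exp_neg_dotProduct_self (i : ι) :
    Integrable fun z : ι → ℝ => z i * exp (-(z ⬝ᵥ z) / 2) := by
  classical
  simpa [Pi.single_apply, pow_ite] using
    integrable_prod_pow_mul_exp_neg_dotProduct_self (Pi.single i 1)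

lemma integral_apply_mul_exp_neg_dotProduct_self (i : ι) :
    ∫ z : ι → ℝ, z i * exp (-(z ⬝ᵥ z) / 2) = 0 := by
  classical
  have h := integral_prod_pow_mul_exp_neg_dotProduct_self (Pi.single i 1)
  rw [Finset.prod_eq_zero (Finset.mem_univ i)] at h
  · simpa [Pi.single_apply, pow_ite] using h
  · simpa using integral_mul_exp_neg_sq_half

lemma prod_pow_single_add_single [DecidableEq ι] (z : ι → ℝ) (i j : ι) :
    ∏ k, z k ^ (Pi.single i 1 + Pi.single j 1 : ι → ℕ) k = z i * z j := by
  simp only [Pi.add_apply, pow_add, Finset.prod_mul_distrib]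
  simp [Pi.single_apply, pow_ite]

lemma integrable_mul_mul_exp_neg_dotProduct_self (i j : ι) :
    Integrable fun z : ι → ℝ => z i * z j * exp (-(z ⬝ᵥ z) / 2) := by
  classical
  have h := integrable_prod_pow_mul_exp_neg_dotProduct_self (Pi.single i 1 + Pi.single j 1)
  simp only [prod_pow_single_add_single] at h
  exact h

lemma integral_mul_mul_exp_neg_dotProduct_self [DecidableEq ι] (i j : ι) :
    ∫ z : ι → ℝ, z i * z j * exp (-(z ⬝ᵥ z) / 2) =
      if i = j then √(2 * π) ^ Fintype.card ι else 0 := by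
  have h := integral_prod_pow_mul_exp_neg_dotProduct_self (Pi.single i 1 + Pi.single j 1)
  simp only [prod_pow_single_add_single] at h
  rw [h]
  split_ifs with hij
  · subst hij
    rw [← Finset.card_univ, ← Finset.prod_const]
    refine Finset.prod_congr rfl fun k _ => ?_
    by_cases hk : k = i
    · subst hk
      simpa using integral_sq_mul_exp_neg_sq_half
    · simpa [hk] using integral_exp_neg_sq_half
  · refine Finset.prod_eq_zero (Finset.mem_univ i) ?_
    simpa [hij] using integral_mul_exp_neg_sq_half

lemma dotProduct_add_const_sq_mul (u z : ι → ℝ) (d e : ℝ) :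
    (u ⬝ᵥ z + d) ^ 2 * e =
      ∑ i, ∑ j, u i * u j * (z i * z j * e) + 2 * d * ∑ i, u i * (z i * e) + d ^ 2 * e := by
  have h1 : ∑ i, ∑ j, u i * u j * (z i * z j * e) = (u ⬝ᵥ z) * (u ⬝ᵥ z) * e := by
    rw [dotProduct, Finset.sum_mul_sum, Finset.sum_mul]
    refine Finset.sum_congr rfl fun i _ => ?_
    rw [Finset.sum_mul]
    exact Finset.sum_congr rfl fun j _ => by ring
  have h2 : ∑ i, u i * (z i * e) = (u ⬝ᵥ z) * e := by
    rw [dotProduct, Finset.sum_mul]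
    exact Finset.sum_congr rfl fun j _ => by ring
  rw [h1, h2]; ring

lemma integrable_dotProduct_add_sq_mul_exp (u : ι → ℝ) (d : ℝ) :
    Integrable fun z : ι → ℝ => (u ⬝ᵥ z + d) ^ 2 * exp (-(z ⬝ᵥ z) / 2) := by
  simp_rw [dotProduct_add_const_sq_mul]
  refine ((integrable_finsetSum _ fun i _ => integrable_finsetSum _ fun j _ => ?_).add
    ((integrable_finsetSum _ fun i _ => ?_).const_mul _)).add ?_
  · exact (integrable_mul_mul_exp_neg_dotProduct_self i j).const_mul _
  · exact (integrable_apply_mul_exp_neg_dotProduct_self i).const_mul _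
  · exact integrable_exp_neg_dotProduct_self.const_mul _

lemma integral_dotProduct_add_sq_mul_exp (u : ι → ℝ) (d : ℝ) :
    ∫ z : ι → ℝ, (u ⬝ᵥ z + d) ^ 2 * exp (-(z ⬝ᵥ z) / 2) =
      √(2 * π) ^ Fintype.card ι * (u ⬝ᵥ u + d ^ 2) := by
  classical
  have i1 := fun i j => (integrable_mul_mul_exp_neg_dotProduct_self (ι := ι) i j).const_mul
    (u i * u j)
  have i2 := fun i => (integrable_apply_mul_exp_neg_dotProduct_self (ι := ι) i).const_mul (u i)
  have i3 := (integrable_exp_neg_dotProduct_self (ι := ι)).const_mul (d ^ 2)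
  have i1' := fun i => integrable_finsetSum Finset.univ fun j _ => i1 i j
  have i1'' := integrable_finsetSum Finset.univ fun i _ => i1' i
  have i2' := (integrable_finsetSum Finset.univ fun i _ => i2 i).const_mul (2 * d)
  simp_rw [dotProduct_add_const_sq_mul]
  rw [integral_add (i1''.fun_add i2') i3, integral_add i1'' i2',
    integral_finsetSum _ fun i _ => i1' i, integral_const_mul, integral_const_mul,
    integral_finsetSum _ fun i _ => i2 i, integral_exp_neg_dotProduct_self]
  simp_rw [integral_finsetSum _ fun j _ => i1 _ j, integral_const_mul,
    integral_apply_mul_exp_neg_dotProduct_self, integral_mul_mul_exp_neg_dotProduct_self]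
  simp [dotProduct, mul_add, Finset.mul_sum, mul_comm]

lemma sq_mul_exp_comp_add_smul {u b : ι → ℝ} {a c t : ℝ} (ha : a ^ 2 = 1 + b ⬝ᵥ b) (ht : 0 < t)
    (z : ι → ℝ) :
    (u ⬝ᵥ (t • z + t ^ 2 • b) + c) ^ 2 *
      (exp (-((a * t) ^ 2 + (√((t • z + t ^ 2 • b) ⬝ᵥ (t • z + t ^ 2 • b)) / t) ^ 2) / 2) *
        exp ((t • z + t ^ 2 • b) ⬝ᵥ b)) =
    exp (-t ^ 2 / 2) * (((t • u) ⬝ᵥ z + (t ^ 2 * (u ⬝ᵥ b) + c)) ^ 2 * exp (-(z ⬝ᵥ z) / 2)) := by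
  rw [div_pow, sq_sqrt (by simpa using dotProduct_star_self_nonneg (t • z + t ^ 2 • b)), ← exp_add,
    mul_left_comm, ← exp_add]
  simp only [dotProduct_add, add_dotProduct, dotProduct_smul, smul_dotProduct, smul_eq_mul,
    mul_pow, ha, dotProduct_comm b z]
  congr 1
  · ring
  · congr 1
    field_simp
    ring

lemma integral_comp_smul_add (f : (ι → ℝ) → ℝ) {t : ℝ} (ht : 0 < t) (v : ι → ℝ) :
    ∫ x, f x = t ^ Fintype.card ι * ∫ z, f (t • z + v) := by
  have h := Measure.integral_comp_smul (volume : Measure (ι → ℝ)) (fun x => f (x + v)) t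
  rw [h, integral_add_right_eq_self, Module.finrank_fintype_fun_eq_card,
    abs_of_pos (by positivity), smul_eq_mul]
  field_simp

lemma integrable_comp_smul_add_iff (f : (ι → ℝ) → ℝ) {t : ℝ} (ht : 0 < t) (v : ι → ℝ) :
    Integrable (fun z => f (t • z + v)) ↔ Integrable f := by
  rw [integrable_comp_smul_iff volume (fun x => f (x + v)) ht.ne']
  exact ⟨fun h => by simpa using h.comp_add_right (-v), fun h => h.comp_add_right v⟩

lemma integrable_sq_mul_exp_mixture {u b : ι → ℝ} {a c t : ℝ} (ha : a ^ 2 = 1 + b ⬝ᵥ b)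
    (ht : 0 < t) :
    Integrable fun x : ι → ℝ => (u ⬝ᵥ x + c) ^ 2 *
      (exp (-((a * t) ^ 2 + (√(x ⬝ᵥ x) / t) ^ 2) / 2) * exp (x ⬝ᵥ b)) := by
  rw [← integrable_comp_smul_add_iff _ ht (t ^ 2 • b)]
  simp_rw [sq_mul_exp_comp_add_smul ha ht]
  exact (integrable_dotProduct_add_sq_mul_exp _ _).const_mul _

lemma integral_sq_mul_exp_mixture {u b : ι → ℝ} {a c t : ℝ} (ha : a ^ 2 = 1 + b ⬝ᵥ b)
    (ht : 0 < t) :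
    ∫ x : ι → ℝ, (u ⬝ᵥ x + c) ^ 2 *
      (exp (-((a * t) ^ 2 + (√(x ⬝ᵥ x) / t) ^ 2) / 2) * exp (x ⬝ᵥ b)) =
    √(2 * π) ^ Fintype.card ι * (t ^ Fintype.card ι * exp (-t ^ 2 / 2) *
      (t ^ 2 * (u ⬝ᵥ u) + (t ^ 2 * (u ⬝ᵥ b) + c) ^ 2)) := by
  rw [integral_comp_smul_add _ ht (t ^ 2 • b)]
  simp_rw [sq_mul_exp_comp_add_smul ha ht]
  rw [integral_const_mul, integral_dotProduct_add_sq_mul_exp]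
  simp only [dotProduct_smul, smul_dotProduct, smul_eq_mul]
  ring

lemma integral_pow_mul_quadratic_mul_exp (n : ℕ) (A B : ℝ) :
    IntegrableOn (fun t : ℝ => t ^ n * exp (-t ^ 2 / 2) *
      (t ^ 2 * A + (t ^ 2 * B + -((n + 1) * B)) ^ 2)) (Set.Ioi 0) ∧
    ∫ t in Set.Ioi (0 : ℝ), t ^ n * exp (-t ^ 2 / 2) *
      (t ^ 2 * A + (t ^ 2 * B + -((n + 1) * B)) ^ 2) =
    (n + 1) * (A + 2 * B ^ 2) * ∫ t in Set.Ioi (0 : ℝ), t ^ n * exp (-t ^ 2 / 2) := by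
  have e : ∀ t : ℝ, t ^ n * exp (-t ^ 2 / 2) * (t ^ 2 * A + (t ^ 2 * B + -((n + 1) * B)) ^ 2) =
      B ^ 2 * (t ^ (n + 2 + 2) * exp (-t ^ 2 / 2)) +
      (A - 2 * (n + 1) * B ^ 2) * (t ^ (n + 2) * exp (-t ^ 2 / 2)) +
      (n + 1) ^ 2 * B ^ 2 * (t ^ n * exp (-t ^ 2 / 2)) := fun t => by ring
  simp_rw [e]
  have i1 := ((integrable_pow_mul_exp_neg_sq_half (n + 2 + 2)).const_mul
    (B ^ 2)).integrableOn (s := Set.Ioi 0)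
  have i2 := ((integrable_pow_mul_exp_neg_sq_half (n + 2)).const_mul
    (A - 2 * (n + 1) * B ^ 2)).integrableOn (s := Set.Ioi 0)
  have i3 := ((integrable_pow_mul_exp_neg_sq_half n).const_mul
    ((n + 1) ^ 2 * B ^ 2)).integrableOn (s := Set.Ioi 0)
  refine ⟨(i1.fun_add i2).fun_add i3, ?_⟩
  rw [integral_add (i1.fun_add i2) i3, integral_add i1 i2, integral_const_mul, integral_const_mul,
    integral_const_mul, integral_pow_add_two_mul_exp_neg_sq_half,
    integral_pow_add_two_mul_exp_neg_sq_half]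
  push_cast
  ring

/-- The total mass of the unnormalized standard skew Laplace density. -/
noncomputable def skewLaplaceMass (n : ℕ) (a : ℝ) : ℝ :=
  2 * a / √(2 * π) * √(2 * π) ^ n * ∫ t in Set.Ioi (0 : ℝ), t ^ n * exp (-t ^ 2 / 2)

lemma integral_sq_mul_skewLaplace {u b : ι → ℝ} {a : ℝ} (ha0 : 0 < a) (ha : a ^ 2 = 1 + b ⬝ᵥ b) :
    Integrable (fun x : ι → ℝ => (u ⬝ᵥ x + -((Fintype.card ι + 1) * (u ⬝ᵥ b))) ^ 2 *
      exp (-a * √(x ⬝ᵥ x) + x ⬝ᵥ b)) ∧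
    ∫ x : ι → ℝ, (u ⬝ᵥ x + -((Fintype.card ι + 1) * (u ⬝ᵥ b))) ^ 2 *
      exp (-a * √(x ⬝ᵥ x) + x ⬝ᵥ b) =
    skewLaplaceMass (Fintype.card ι) a *
      ((Fintype.card ι + 1) * (u ⬝ᵥ u + 2 * (u ⬝ᵥ b) ^ 2)) := by
  set n := Fintype.card ι with hn
  set c : ℝ := -((n + 1) * (u ⬝ᵥ b)) with hc
  let F : ℝ → (ι → ℝ) → ℝ := fun t x => (u ⬝ᵥ x + c) ^ 2 *
      (exp (-((a * t) ^ 2 + (√(x ⬝ᵥ x) / t) ^ 2) / 2) * exp (x ⬝ᵥ b))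
  have hFnn : ∀ t x, 0 ≤ F t x := fun t x => by positivity
  have hFx : ∀ t ∈ Set.Ioi (0 : ℝ), ∫ x, F t x = √(2 * π) ^ n * (t ^ n * exp (-t ^ 2 / 2) *
      (t ^ 2 * (u ⬝ᵥ u) + (t ^ 2 * (u ⬝ᵥ b) + c) ^ 2)) :=
    fun t ht => integral_sq_mul_exp_mixture ha ht
  have hFt : ∀ x, ∫ t in Set.Ioi (0 : ℝ), F t x =
      √(2 * π) / (2 * a) * ((u ⬝ᵥ x + c) ^ 2 * exp (-a * √(x ⬝ᵥ x) + x ⬝ᵥ b)) := fun x => by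
    simp only [F]
    rw [integral_const_mul, integral_mul_const,
      integral_exp_neg_sq_add_sq_div ha0 (sqrt_nonneg _), exp_add, neg_mul]
    ring
  have hFmeas : AEStronglyMeasurable (Function.uncurry F)
      ((volume.restrict (Set.Ioi 0)).prod volume) := by
    simp only [F, Function.uncurry_def, dotProduct]
    exact Measurable.aestronglyMeasurable (by fun_prop)
  obtain ⟨hint, hval⟩ := integral_pow_mul_quadratic_mul_exp n (u ⬝ᵥ u) (u ⬝ᵥ b)
  have hF : Integrable (Function.uncurry F) ((volume.restrict (Set.Ioi 0)).prod volume) := by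
    rw [integrable_prod_iff hFmeas]
    refine ⟨(ae_restrict_iff' measurableSet_Ioi).2
      (.of_forall fun t ht => integrable_sq_mul_exp_mixture ha ht), ?_⟩
    simp only [Function.uncurry_apply_pair, norm_of_nonneg (hFnn _ _)]
    exact (integrableOn_congr_fun hFx measurableSet_Ioi).2 (hint.const_mul _)
  have hpos : 0 < √(2 * π) := by positivity
  constructor
  · have := hF.integral_prod_right
    simp only [Function.uncurry_apply_pair, hFt] at this
    exact (integrable_const_mul_iff (IsUnit.mk0 _ (by positivity)) _).1 this
  · have := integral_integral_swap hF
    simp_rw [hFt] at this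
    rw [setIntegral_congr_fun measurableSet_Ioi hFx, integral_const_mul, integral_const_mul,
      hval] at this
    rw [skewLaplaceMass]
    field_simp
    field_simp at this
    linarith

lemma integral_mul_mul_skewLaplace {u v b : ι → ℝ} {a : ℝ} (ha0 : 0 < a)
    (ha : a ^ 2 = 1 + b ⬝ᵥ b) :
    ∫ x : ι → ℝ, (u ⬝ᵥ x - (Fintype.card ι + 1) * (u ⬝ᵥ b)) *
      (v ⬝ᵥ x - (Fintype.card ι + 1) * (v ⬝ᵥ b)) * exp (-a * √(x ⬝ᵥ x) + x ⬝ᵥ b) =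
    skewLaplaceMass (Fintype.card ι) a *
      ((Fintype.card ι + 1) * (u ⬝ᵥ v + 2 * (u ⬝ᵥ b) * (v ⬝ᵥ b))) := by
  obtain ⟨i1, h1⟩ := integral_sq_mul_skewLaplace (u := u + v) ha0 ha
  obtain ⟨i2, h2⟩ := integral_sq_mul_skewLaplace (u := u - v) ha0 ha
  have := integral_sub i1 i2
  rw [h1, h2] at this
  have e : ∀ x : ι → ℝ, (u ⬝ᵥ x - (Fintype.card ι + 1) * (u ⬝ᵥ b)) *
      (v ⬝ᵥ x - (Fintype.card ι + 1) * (v ⬝ᵥ b)) * exp (-a * √(x ⬝ᵥ x) + x ⬝ᵥ b) =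
      1 / 4 * (((u + v) ⬝ᵥ x + -((Fintype.card ι + 1) * ((u + v) ⬝ᵥ b))) ^ 2 *
        exp (-a * √(x ⬝ᵥ x) + x ⬝ᵥ b) -
      ((u - v) ⬝ᵥ x + -((Fintype.card ι + 1) * ((u - v) ⬝ᵥ b))) ^ 2 *
        exp (-a * √(x ⬝ᵥ x) + x ⬝ᵥ b)) := fun x => by
    simp only [add_dotProduct, sub_dotProduct]
    ring
  simp_rw [e]
  rw [integral_const_mul, this]
  simp only [add_dotProduct, sub_dotProduct, dotProduct_add, dotProduct_sub, dotProduct_comm v u]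
  ring

lemma integral_comp_mulVec_add [DecidableEq ι] {A : Matrix ι ι ℝ} (hA : A.det ≠ 0)
    (f : (ι → ℝ) → ℝ) (v : ι → ℝ) :
    ∫ y, f y = |A.det| * ∫ x, f (A *ᵥ x + v) := by
  let e := (LinearEquiv.ofIsUnitDet (f := toLin' A) (v := Pi.basisFun ℝ ι) (v' := Pi.basisFun ℝ ι)
    (by simpa [LinearMap.toMatrix_eq_toMatrix'] using hA)).toContinuousLinearEquiv
  have he : MeasurableEmbedding (toLin' A) := e.toHomeomorph.measurableEmbedding
  have h := he.integral_map (μ := volume) (fun x => f (x + v))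
  rw [Real.map_matrix_volume_pi_eq_smul_volume_pi hA, integral_smul_measure,
    ENNReal.toReal_ofReal (abs_nonneg _), integral_add_right_eq_self, abs_inv, smul_eq_mul] at h
  simp only [toLin'_apply] at h
  rw [← h]
  field_simp

end

lemma skewLaplaceMass_eq (p : ℕ) (a : ℝ) :
    skewLaplaceMass p a =
      2 ^ p * π ^ (((p : ℝ) - 1) / 2) * a * Gamma (((p : ℝ) + 1) / 2) := by
  have h1 : √(2 * π) ^ p / √(2 * π) = 2 ^ (((p : ℝ) - 1) / 2) * π ^ (((p : ℝ) - 1) / 2) := by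
    rw [← mul_rpow (by norm_num) pi_pos.le, sqrt_eq_rpow, ← rpow_natCast, ← rpow_mul (by positivity),
      ← rpow_sub (by positivity)]
    congr 1; ring
  have h2 : (2 : ℝ) * 2 ^ (((p : ℝ) - 1) / 2) * 2 ^ (((p : ℝ) - 1) / 2) = 2 ^ p := by
    rw [mul_assoc, ← rpow_add two_pos, add_halves, rpow_sub_one two_ne_zero, rpow_natCast]
    field_simp
  rw [skewLaplaceMass, integral_pow_mul_exp_neg_sq_half, ← h2]
  linear_combination 2 * a * 2 ^ (((p : ℝ) - 1) / 2) * Gamma (((p : ℝ) + 1) / 2) * h1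

lemma exists_det_ne_zero_eq_mul_transpose {p : ℕ} {S : Matrix (Fin p) (Fin p) ℝ}
    (hS : S.PosDef) : ∃ A : Matrix (Fin p) (Fin p) ℝ, A.det ≠ 0 ∧ S = A * Aᵀ := by
  open scoped MatrixOrder in
  obtain ⟨B, rfl⟩ := CStarAlgebra.nonneg_iff_eq_star_mul_self.mp hS.posSemidef.nonneg
  refine ⟨Bᵀ, fun h => hS.det_pos.ne' ?_, ?_⟩
  · rw [det_transpose] at h
    rw [det_mul, h, mul_zero]
  · rw [transpose_transpose, star_eq_conjTranspose, conjTranspose_eq_transpose_of_trivial]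

lemma dotProduct_mulVec_inv_mul_transpose {ι : Type*} [Fintype ι] [DecidableEq ι]
    {A : Matrix ι ι ℝ} (hA : A.det ≠ 0) (x y : ι → ℝ) :
    (A *ᵥ x) ⬝ᵥ (A * Aᵀ)⁻¹ *ᵥ (A *ᵥ y) = x ⬝ᵥ y := by
  have hu : IsUnit A.det := isUnit_iff_ne_zero.2 hA
  have hu' : IsUnit Aᵀ.det := by rwa [det_transpose]
  rw [Matrix.mul_inv_rev, mulVec_mulVec, mul_assoc, nonsing_inv_mul _ hu, mul_one, ← vecMul_transpose,
    ← dotProduct_mulVec, mulVec_mulVec, mul_nonsing_inv _ hu', one_mulVec]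

/-- The covariance matrix of the multivariate skew Laplace distribution
`MSL_p(μ, Σ, γ)` is `(p+1)(Σ + 2γγᵀ)`. -/
theorem msl_covariance
    (p : ℕ) (hp : 1 ≤ p) (μ γ : Fin p → ℝ)
    (S : Matrix (Fin p) (Fin p) ℝ) (hS : S.PosDef) (k l : Fin p) :
    ∫ y : Fin p → ℝ,
      (y k - (μ k + ((p : ℝ) + 1) * γ k)) * (y l - (μ l + ((p : ℝ) + 1) * γ l)) *
      (S.det ^ (-(1:ℝ)/2) /
          ((2:ℝ) ^ p * π ^ (((p:ℝ) - 1)/2) *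
            Real.sqrt (1 + γ ⬝ᵥ S⁻¹ *ᵥ γ) * Real.Gamma (((p:ℝ) + 1)/2)) *
        Real.exp (-(Real.sqrt (1 + γ ⬝ᵥ S⁻¹ *ᵥ γ)) *
            Real.sqrt ((y - μ) ⬝ᵥ S⁻¹ *ᵥ (y - μ)) +
          (y - μ) ⬝ᵥ S⁻¹ *ᵥ γ))
    = ((p : ℝ) + 1) * (S k l + 2 * γ k * γ l) := by
  obtain ⟨A, hA, rfl⟩ := exists_det_ne_zero_eq_mul_transpose hS
  obtain ⟨b, rfl⟩ : ∃ b, γ = A *ᵥ b :=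
    ⟨A⁻¹ *ᵥ γ, by rw [mulVec_mulVec, mul_nonsing_inv _ (isUnit_iff_ne_zero.2 hA), one_mulVec]⟩
  have hb : 0 ≤ b ⬝ᵥ b := by simpa using dotProduct_star_self_nonneg b
  rw [integral_comp_mulVec_add hA _ μ, ← skewLaplaceMass_eq]
  simp only [add_sub_cancel_right, dotProduct_mulVec_inv_mul_transpose hA]
  set a := √(1 + b ⬝ᵥ b) with ha
  have ha0 : 0 < a := by positivity
  have hM : skewLaplaceMass p a ≠ 0 := by
    rw [skewLaplaceMass_eq]
    have := Gamma_pos_of_pos (s := ((p : ℝ) + 1) / 2) (by positivity)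
    positivity
  have hd : |A.det| * (A * Aᵀ).det ^ (-(1 : ℝ) / 2) = 1 := by
    rw [det_mul, det_transpose, ← sq, neg_div, rpow_neg (sq_nonneg _), ← sqrt_eq_rpow,
      sqrt_sq_eq_abs, mul_inv_cancel₀ (abs_ne_zero.2 hA)]
  have hI := integral_mul_mul_skewLaplace (u := A k) (v := A l) ha0 (sq_sqrt (by positivity))
  rw [Fintype.card_fin] at hI
  have e : ∀ x : Fin p → ℝ, ((A *ᵥ x + μ) k - (μ k + ((p : ℝ) + 1) * (A *ᵥ b) k)) *
      ((A *ᵥ x + μ) l - (μ l + ((p : ℝ) + 1) * (A *ᵥ b) l)) *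
      ((A * Aᵀ).det ^ (-(1:ℝ)/2) / skewLaplaceMass p a * exp (-a * √(x ⬝ᵥ x) + x ⬝ᵥ b)) =
      (A * Aᵀ).det ^ (-(1:ℝ)/2) / skewLaplaceMass p a *
      ((A k ⬝ᵥ x - (p + 1) * (A k ⬝ᵥ b)) * (A l ⬝ᵥ x - (p + 1) * (A l ⬝ᵥ b)) *
        exp (-a * √(x ⬝ᵥ x) + x ⬝ᵥ b)) := fun x => by
    simp only [Pi.add_apply, mulVec]
    ring
  simp_rw [e]
  rw [integral_const_mul, hI, show (A * Aᵀ) k l = A k ⬝ᵥ A l from rfl]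
  simp only [mulVec]
  generalize (A * Aᵀ).det ^ (-(1 : ℝ) / 2) = D at hd ⊢
  field_simp
  linear_combination (A k ⬝ᵥ A l + 2 * (A k ⬝ᵥ b) * (A l ⬝ᵥ b)) * hd
end

section
/- The MSL distribution is a variance–mean mixture of a multivariate normal with an inverse gamma mixing distribution: for every integer p ≥ 1, every μ, γ ∈ ℝ^p, every symmetric positive definite p×p real matrix Σ, and every y ∈ ℝ^p, one has ∫_0^∞ φ_p(y; μ + v^{-1}γ, v^{-1}Σ) · g(v) dv = f_MSL(y). -/
open MeasureTheory Real Matrix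
open Filter Topology

lemma integral_Ioi_of_hasDerivAt_of_nonneg_of_tendsto {f f' : ℝ → ℝ} {a l m : ℝ}
    (hderiv : ∀ x ∈ Set.Ioi a, HasDerivAt f (f' x) x) (hnonneg : ∀ x ∈ Set.Ioi a, 0 ≤ f' x)
    (hleft : Tendsto f (𝓝[>] a) (𝓝 l)) (htop : Tendsto f atTop (𝓝 m)) :
    ∫ x in Set.Ioi a, f' x = m - l := by
  have hcont : ContinuousWithinAt (Function.update f a l) (Set.Ici a) a := by
    rw [continuousWithinAt_update_same, Set.Ici_sdiff_left]
    exact hleft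
  have heq : ∀ x ∈ Set.Ioi a, Function.update f a l =ᶠ[𝓝 x] f := fun x hx => by
    filter_upwards [Ioi_mem_nhds hx] with z hz
    exact Function.update_of_ne (ne_of_gt hz) _ _
  have htop' : Tendsto (Function.update f a l) atTop (𝓝 m) := by
    refine htop.congr' ?_
    filter_upwards [eventually_gt_atTop a] with z hz
    exact (Function.update_of_ne (ne_of_gt hz) _ _).symm
  simpa using integral_Ioi_of_hasDerivAt_of_nonneg hcont
    (fun x hx => (hderiv x hx).congr_of_eventuallyEq (heq x hx)) hnonneg htop'

/-- The primitive of `t ↦ exp (-t² / 2)` vanishing at `0`. -/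
noncomputable def gaussianPrimitive (x : ℝ) : ℝ := ∫ t in (0 : ℝ)..x, exp (-(1 / 2) * t ^ 2)

lemma hasDerivAt_gaussianPrimitive (x : ℝ) :
    HasDerivAt gaussianPrimitive (exp (-(1 / 2) * x ^ 2)) x :=
  (show Continuous fun t : ℝ => exp (-(1 / 2) * t ^ 2) by fun_prop).integral_hasStrictDerivAt 0 x
    |>.hasDerivAt

lemma gaussianPrimitive_neg (x : ℝ) : gaussianPrimitive (-x) = -gaussianPrimitive x := by
  have h := intervalIntegral.integral_comp_neg (a := 0) (b := x)
    fun t : ℝ => exp (-(1 / 2) * t ^ 2)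
  simp only [even_two.neg_pow, neg_zero] at h
  rw [gaussianPrimitive, gaussianPrimitive, h, ← intervalIntegral.integral_symm]

lemma tendsto_gaussianPrimitive_atTop :
    Tendsto gaussianPrimitive atTop (𝓝 (√(2 * π) / 2)) := by
  have h := intervalIntegral_tendsto_integral_Ioi 0
    (integrable_exp_neg_mul_sq (b := 1 / 2) (by norm_num)).integrableOn tendsto_id
  rw [integral_gaussian_Ioi, show π / (1 / 2) = 2 * π by ring] at h
  exact h

lemma tendsto_gaussianPrimitive_atBot :
    Tendsto gaussianPrimitive atBot (𝓝 (-(√(2 * π) / 2))) := by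
  refine (tendsto_gaussianPrimitive_atTop.comp tendsto_neg_atBot_atTop).neg.congr fun x => ?_
  simp [gaussianPrimitive_neg]

lemma rpow_neg_three_halves {v : ℝ} (hv : 0 < v) : v ^ (-(3 / 2) : ℝ) = (v * √v)⁻¹ := by
  rw [rpow_neg hv.le, show (3 / 2 : ℝ) = 1 + 1 / 2 by norm_num, rpow_add hv, rpow_one,
    ← sqrt_eq_rpow]

/-- The normalisation of the inverse Gaussian density, including the degenerate case `b = 0`. -/
lemma integral_rpow_neg_three_halves_mul_exp {a b : ℝ} (ha : 0 < a) (hb : 0 ≤ b) :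
    ∫ v in Set.Ioi (0 : ℝ), v ^ (-(3 / 2) : ℝ) * exp (-(1 / 2) * (b ^ 2 * v + a ^ 2 / v)) =
      √(2 * π) / a * exp (-(a * b)) := by
  set L := √(2 * π) / 2 with hL
  let F : ℝ → ℝ := fun v =>
    gaussianPrimitive (b * √v - a / √v) - exp (2 * a * b) * gaussianPrimitive (b * √v + a / √v)
  have hderiv : ∀ v ∈ Set.Ioi (0 : ℝ), HasDerivAt F (a * exp (a * b) *
      (v ^ (-(3 / 2) : ℝ) * exp (-(1 / 2) * (b ^ 2 * v + a ^ 2 / v)))) v := by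
    intro v hv
    have hv : 0 < v := hv
    have hs : 0 < √v := sqrt_pos.2 hv
    have hsq : √v ^ 2 = v := sq_sqrt hv.le
    have h1 : HasDerivAt (fun v => √v) (1 / (2 * √v)) v := hasDerivAt_sqrt hv.ne'
    have h2 : HasDerivAt (fun v => a / √v) (-(a * (1 / (2 * √v))) / √v ^ 2) v := by
      convert! (hasDerivAt_const v a).div h1 hs.ne' using 1
      ring
    have h3 := (hasDerivAt_gaussianPrimitive _).comp v ((h1.const_mul b).sub h2)
    have h4 := (hasDerivAt_gaussianPrimitive _).comp v ((h1.const_mul b).add h2)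
    convert! h3.sub (h4.const_mul (exp (2 * a * b))) using 1
    have e1 : exp (-(1 / 2) * (b * √v - a / √v) ^ 2) =
        exp (a * b) * exp (-(1 / 2) * (b ^ 2 * v + a ^ 2 / v)) := by
      rw [← exp_add, ← hsq]
      simp only [sqrt_sq hs.le]
      congr 1
      field_simp
      ring
    have e2 : exp (2 * a * b) * exp (-(1 / 2) * (b * √v + a / √v) ^ 2) =
        exp (a * b) * exp (-(1 / 2) * (b ^ 2 * v + a ^ 2 / v)) := by
      rw [← exp_add, ← exp_add, ← hsq]
      simp only [sqrt_sq hs.le]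
      congr 1
      field_simp
      ring
    simp only [Pi.sub_apply, Pi.add_apply]
    rw [← mul_assoc (exp (2 * a * b)), e1, e2, rpow_neg_three_halves hv, hsq]
    field_simp
    ring
  have hsqrt0 : Tendsto (fun v : ℝ => √v) (𝓝[>] 0) (𝓝[>] 0) := by
    refine tendsto_nhdsWithin_iff.2 ⟨?_, ?_⟩
    · simpa using (continuous_sqrt.tendsto 0).mono_left nhdsWithin_le_nhds
    · filter_upwards [self_mem_nhdsWithin] with v hv using sqrt_pos.2 hv
  have hmul0 : Tendsto (fun v : ℝ => b * √v) (𝓝[>] 0) (𝓝 0) := by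
    simpa using (hsqrt0.mono_right nhdsWithin_le_nhds).const_mul b
  have hdiv0 : Tendsto (fun v : ℝ => a / √v) (𝓝[>] 0) atTop := by
    simpa only [div_eq_mul_inv, Function.comp_def] using (tendsto_inv_nhdsGT_zero.comp hsqrt0).const_mul_atTop ha
  have hleft : Tendsto F (𝓝[>] 0) (𝓝 (-L - exp (2 * a * b) * L)) := by
    refine (tendsto_gaussianPrimitive_atBot.comp ?_).sub
      ((tendsto_gaussianPrimitive_atTop.comp (hmul0.add_atTop hdiv0)).const_mul _)
    simpa only [sub_eq_add_neg, Function.comp_def] using hmul0.add_atBot (tendsto_neg_atTop_atBot.comp hdiv0)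
  have hdivtop : Tendsto (fun v : ℝ => a / √v) atTop (𝓝 0) :=
    tendsto_const_nhds.div_atTop tendsto_sqrt_atTop
  have htop : Tendsto F atTop (𝓝 (L - exp (2 * a * b) * L)) := by
    rcases hb.eq_or_lt with rfl | hb
    · have h : F = fun v => -2 * gaussianPrimitive (a / √v) := by
        funext v
        simp only [F, zero_mul, zero_sub, zero_add, mul_zero, exp_zero, gaussianPrimitive_neg]
        ring
      rw [h]
      have h0 := (hasDerivAt_gaussianPrimitive 0).continuousAt.tendsto.comp hdivtop
      simpa [gaussianPrimitive] using h0.const_mul (-2)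
    · have hmul : Tendsto (fun v : ℝ => b * √v) atTop atTop :=
        tendsto_sqrt_atTop.const_mul_atTop hb
      refine (tendsto_gaussianPrimitive_atTop.comp ?_).sub
        ((tendsto_gaussianPrimitive_atTop.comp (hmul.atTop_add hdivtop)).const_mul _)
      simpa only [sub_eq_add_neg] using hmul.atTop_add hdivtop.neg
  have hFTC := integral_Ioi_of_hasDerivAt_of_nonneg_of_tendsto hderiv
    (fun v hv => by have : 0 < v := hv; positivity) hleft htop
  rw [integral_const_mul] at hFTC
  rw [Real.exp_neg, ← div_eq_mul_inv, div_div, eq_div_iff (by positivity)]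
  rw [hL] at hFTC
  linear_combination hFTC

lemma dotProduct_mulVec_comm_of_isSymm {n : Type*} [Fintype n] {M : Matrix n n ℝ}
    (hM : M.IsSymm) (x z : n → ℝ) : x ⬝ᵥ M *ᵥ z = z ⬝ᵥ M *ᵥ x := by
  rw [dotProduct_mulVec, ← mulVec_transpose, hM.eq, dotProduct_comm]

lemma scaled_quadForm_sub {n : Type*} [Fintype n] {M : Matrix n n ℝ} (hM : M.IsSymm)
    (x z : n → ℝ) {v : ℝ} (hv : v ≠ 0) :
    (x - v⁻¹ • z) ⬝ᵥ (v • M) *ᵥ (x - v⁻¹ • z) =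
      v * (x ⬝ᵥ M *ᵥ x) - 2 * (x ⬝ᵥ M *ᵥ z) + (z ⬝ᵥ M *ᵥ z) / v := by
  simp only [smul_mulVec, mulVec_sub, mulVec_smul, dotProduct_sub, sub_dotProduct,
    dotProduct_smul, smul_dotProduct, smul_eq_mul, dotProduct_mulVec_comm_of_isSymm hM z x]
  field_simp
  ring

lemma msl_normalizing_constant (p : ℝ) :
    (2 * π) ^ (-p / 2) * (1 / 2 : ℝ) ^ ((p + 1) / 2) * √(2 * π) =
      ((2 : ℝ) ^ p * π ^ ((p - 1) / 2))⁻¹ := by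
  have hpi := pi_pos
  rw [sqrt_eq_rpow, mul_right_comm, ← rpow_add (by positivity), one_div, inv_rpow (by norm_num),
    ← rpow_neg (by norm_num), mul_rpow (by norm_num) hpi.le, mul_inv, ← rpow_neg (by norm_num),
    ← rpow_neg hpi.le, mul_right_comm, ← rpow_add (by norm_num)]
  congr 2 <;> ring

/-- The MSL distribution is a variance–mean mixture of a multivariate normal with an
inverse gamma `IG((p+1)/2, 1/2)` mixing distribution:
`∫_0^∞ φ_p(y; μ + v⁻¹γ, v⁻¹Σ) g(v) dv = f_MSL(y)`. -/
theorem msl_is_normal_inverse_gamma_mixture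
    (p : ℕ) (hp : 1 ≤ p) (μ γ : Fin p → ℝ)
    (S : Matrix (Fin p) (Fin p) ℝ) (hS : S.PosDef) (y : Fin p → ℝ) :
    ∫ v in Set.Ioi (0:ℝ),
      ((2 * π) ^ (-(p:ℝ)/2) * (v⁻¹ • S).det ^ (-(1:ℝ)/2) *
        Real.exp (-(1/2) *
          ((y - (μ + v⁻¹ • γ)) ⬝ᵥ (v⁻¹ • S)⁻¹ *ᵥ (y - (μ + v⁻¹ • γ))))) *
      ((1/2 : ℝ) ^ (((p:ℝ) + 1)/2) / Real.Gamma (((p:ℝ) + 1)/2) *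
        v ^ (-(((p:ℝ) + 3)/2)) * Real.exp (-1/(2*v)))
    = S.det ^ (-(1:ℝ)/2) /
        ((2:ℝ) ^ p * π ^ (((p:ℝ) - 1)/2) *
          Real.sqrt (1 + γ ⬝ᵥ S⁻¹ *ᵥ γ) * Real.Gamma (((p:ℝ) + 1)/2)) *
      Real.exp (-(Real.sqrt (1 + γ ⬝ᵥ S⁻¹ *ᵥ γ)) *
          Real.sqrt ((y - μ) ⬝ᵥ S⁻¹ *ᵥ (y - μ)) +
        (y - μ) ⬝ᵥ S⁻¹ *ᵥ γ) := by
  have hpos : ∀ x, 0 ≤ x ⬝ᵥ S⁻¹ *ᵥ x := fun x => by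
    simpa using hS.inv.posSemidef.dotProduct_mulVec_nonneg x
  have hsymm : S⁻¹.IsSymm := by
    simpa [IsHermitian, IsSymm, conjTranspose_eq_transpose_of_trivial] using hS.inv.isHermitian
  have hdet := hS.det_pos
  set q := (y - μ) ⬝ᵥ S⁻¹ *ᵥ (y - μ) with hq
  set r := γ ⬝ᵥ S⁻¹ *ᵥ γ with hr
  set s := (y - μ) ⬝ᵥ S⁻¹ *ᵥ γ with hs
  have hq0 : 0 ≤ q := hpos _
  have hr0 : 0 ≤ r := hpos _
  have hα : 0 < √(1 + r) := sqrt_pos.2 (by linarith)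
  have hG : 0 < Gamma (((p : ℝ) + 1) / 2) := Gamma_pos_of_pos (by positivity)
  set c := (2 * π) ^ (-(p : ℝ) / 2) * S.det ^ (-(1 : ℝ) / 2) * exp s *
    ((1 / 2 : ℝ) ^ (((p : ℝ) + 1) / 2) / Gamma (((p : ℝ) + 1) / 2)) with hc
  trans ∫ v in Set.Ioi (0 : ℝ), c *
    (v ^ (-(3 / 2) : ℝ) * exp (-(1 / 2) * (√q ^ 2 * v + √(1 + r) ^ 2 / v)))
  · refine setIntegral_congr_fun measurableSet_Ioi fun v hv => ?_
    have hv : 0 < v := hv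
    have hinv : (v⁻¹ • S)⁻¹ = v • S⁻¹ := by
      rw [show v⁻¹ • S = (Units.mk0 v hv.ne')⁻¹ • S from rfl,
        inv_smul' _ _ hdet.ne'.isUnit, inv_inv]
      rfl
    have hvdet : (v⁻¹ • S).det ^ (-(1 : ℝ) / 2) = v ^ ((p : ℝ) / 2) * S.det ^ (-(1 : ℝ) / 2) := by
      rw [det_smul, Fintype.card_fin, mul_rpow (by positivity) hdet.le, ← rpow_natCast,
        inv_rpow hv.le, ← rpow_neg hv.le, ← rpow_mul hv.le]
      congr 2
      ring
    have hvpow : v ^ (-(3 / 2) : ℝ) = v ^ ((p : ℝ) / 2) * v ^ (-(((p : ℝ) + 3) / 2)) := by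
      rw [← rpow_add hv]
      congr 1
      ring
    have hexp : exp (-(1 / 2) * (v * q - 2 * s + r / v)) * exp (-1 / (2 * v)) =
        exp s * exp (-(1 / 2) * (q * v + (1 + r) / v)) := by
      rw [← exp_add, ← exp_add]
      congr 1
      field_simp
      ring
    rw [hinv, hvdet, ← sub_sub, scaled_quadForm_sub hsymm _ _ hv.ne', sq_sqrt hq0,
      sq_sqrt (by linarith), hvpow, ← hq, ← hr, ← hs, hc]
    linear_combination ((2 * π) ^ (-(p : ℝ) / 2) * (v ^ ((p : ℝ) / 2) * S.det ^ (-(1 : ℝ) / 2)) *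
      ((1 / 2 : ℝ) ^ (((p : ℝ) + 1) / 2) / Gamma (((p : ℝ) + 1) / 2) *
        v ^ (-(((p : ℝ) + 3) / 2)))) * hexp
  · rw [integral_const_mul, integral_rpow_neg_three_halves_mul_exp hα (sqrt_nonneg q), exp_add,
      neg_mul]
    have hconst := msl_normalizing_constant p
    rw [rpow_natCast] at hconst
    trans (2 * π) ^ (-(p : ℝ) / 2) * (1 / 2 : ℝ) ^ (((p : ℝ) + 1) / 2) * √(2 * π) *
      (S.det ^ (-(1 : ℝ) / 2) / (√(1 + r) * Gamma (((p : ℝ) + 1) / 2)) *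
        (exp (-(√(1 + r) * √q)) * exp s))
    · rw [hc]
      field_simp
    · rw [hconst]
      field_simp
end

section
/- (Proposition 2, formula (4)) For every integer p ≥ 1, every μ, γ ∈ ℝ^p, every symmetric positive definite p×p real matrix Σ and every y ∈ ℝ^p with y ≠ μ, writing a = (y−μ)ᵀΣ⁻¹(y−μ) > 0 and α = √(1 + γᵀΣ⁻¹γ), the conditional expectation E(V | y) = ∫_0^∞ v · h(v) dv equals √(1 + γᵀΣ⁻¹γ) / √((y−μ)ᵀΣ⁻¹(y−μ)), i.e. α/√a. -/
open MeasureTheory Real Matrix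

theorem image_const_div_Ioi {c : ℝ} (hc : 0 < c) :
    (fun x : ℝ => c / x) '' Set.Ioi 0 = Set.Ioi 0 := by
  ext z
  constructor
  · rintro ⟨x, hx, rfl⟩
    exact div_pos hc hx
  · intro hz
    exact ⟨c / z, div_pos hc hz, div_div_cancel₀ hc.ne'⟩

theorem image_mul_sub_div_Ioi {s r : ℝ} (hs : 0 < s) (hr : 0 < r) :
    (fun x : ℝ => s * x - r / x) '' Set.Ioi 0 = Set.univ := by
  refine Set.eq_univ_of_forall fun u => ?_
  have hd : 0 < u ^ 2 + 4 * s * r := by positivity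
  have hq : √(u ^ 2 + 4 * s * r) ^ 2 = u ^ 2 + 4 * s * r := Real.sq_sqrt hd.le
  have hlt : |u| < √(u ^ 2 + 4 * s * r) :=
    Real.lt_sqrt_of_sq_lt (by rw [sq_abs]; linarith [mul_pos hs hr])
  have hx : 0 < u + √(u ^ 2 + 4 * s * r) := by linarith [neg_abs_le u]
  refine ⟨(u + √(u ^ 2 + 4 * s * r)) / (2 * s), div_pos hx (by positivity), ?_⟩
  generalize √(u ^ 2 + 4 * s * r) = q at hq hx
  have hx' := hx.ne'
  simp only
  rw [div_div_eq_mul_div, mul_div_assoc', sub_eq_iff_eq_add, div_eq_iff (by positivity)]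
  field_simp
  linear_combination hq

theorem injOn_mul_sub_div_Ioi {s r : ℝ} (hs : 0 < s) (hr : 0 < r) :
    Set.InjOn (fun x : ℝ => s * x - r / x) (Set.Ioi 0) := by
  refine StrictMonoOn.injOn fun x hx y hy hxy => ?_
  have h₁ : r / y < r / x := div_lt_div_of_pos_left hr hx hxy
  have h₂ : s * x < s * y := mul_lt_mul_of_pos_left hxy hs
  linarith

theorem hasDerivAt_const_div {c x : ℝ} (hx : x ≠ 0) :
    HasDerivAt (fun x : ℝ => c / x) (-(c / x ^ 2)) x := by
  simpa [div_eq_mul_inv] using (hasDerivAt_inv hx).const_mul c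

theorem integrableOn_and_integral_deriv_mul_exp {s r : ℝ} (hs : 0 < s) (hr : 0 < r) :
    IntegrableOn (fun x : ℝ => (s + r / x ^ 2) * exp (-(1 / 2) * (s * x - r / x) ^ 2))
        (Set.Ioi 0) ∧
      ∫ x in Set.Ioi (0 : ℝ), (s + r / x ^ 2) * exp (-(1 / 2) * (s * x - r / x) ^ 2)
        = √(2 * π) := by
  have hderiv : ∀ x ∈ Set.Ioi (0 : ℝ), HasDerivWithinAt (fun x : ℝ => s * x - r / x)
      (s + r / x ^ 2) (Set.Ioi 0) x := fun x hx => by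
    have h := ((hasDerivAt_id x).const_mul s).sub
      (hasDerivAt_const_div (c := r) (ne_of_gt hx))
    simp only [mul_one, sub_neg_eq_add] at h
    exact h.hasDerivWithinAt
  have habs : ∀ x ∈ Set.Ioi (0 : ℝ),
      |s + r / x ^ 2| • exp (-(1 / 2) * (s * x - r / x) ^ 2)
        = (s + r / x ^ 2) * exp (-(1 / 2) * (s * x - r / x) ^ 2) := fun x _ => by
    rw [abs_of_pos (by positivity), smul_eq_mul]
  have hinj := injOn_mul_sub_div_Ioi hs hr
  constructor
  · have h := (integrableOn_image_iff_integrableOn_abs_deriv_smul measurableSet_Ioi hderiv hinj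
      (fun u : ℝ => exp (-(1 / 2) * u ^ 2))).1
      (integrable_exp_neg_mul_sq (by norm_num)).integrableOn
    exact h.congr_fun habs measurableSet_Ioi
  · have h := integral_image_eq_integral_abs_deriv_smul measurableSet_Ioi hderiv hinj
      (fun u : ℝ => exp (-(1 / 2) * u ^ 2))
    rw [image_mul_sub_div_Ioi hs hr, setIntegral_univ, integral_gaussian,
      setIntegral_congr_fun measurableSet_Ioi habs] at h
    rw [← h]
    congr 1
    ring

theorem integral_exp_sq_mul_sub_div_comp_inv {s r : ℝ} (hs : 0 < s) (hr : 0 < r) :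
    ∫ x in Set.Ioi (0 : ℝ), r / x ^ 2 * exp (-(1 / 2) * (s * x - r / x) ^ 2)
      = s * ∫ x in Set.Ioi (0 : ℝ), exp (-(1 / 2) * (s * x - r / x) ^ 2) := by
  have hc : 0 < r / s := div_pos hr hs
  have h := integral_image_eq_integral_abs_deriv_smul (s := Set.Ioi (0 : ℝ)) measurableSet_Ioi
    (fun x hx => (hasDerivAt_const_div (c := r / s) (ne_of_gt hx)).hasDerivWithinAt)
    (fun x hx y hy hxy => by
      have hx' := ne_of_gt (Set.mem_Ioi.1 hx)
      have hy' := ne_of_gt (Set.mem_Ioi.1 hy)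
      simp only at hxy
      field_simp at hxy
      exact hxy.symm)
    (fun x : ℝ => exp (-(1 / 2) * (s * x - r / x) ^ 2))
  rw [image_const_div_Ioi hc] at h
  rw [h, ← integral_const_mul]
  refine setIntegral_congr_fun measurableSet_Ioi fun x hx => ?_
  have hx' : 0 < x := hx
  have hsq : s * (r / s / x) - r / (r / s / x) = -(s * x - r / x) := by
    field_simp
    ring
  rw [hsq, neg_sq, abs_neg, abs_of_pos (by positivity), smul_eq_mul]
  field_simp

theorem integral_exp_sq_mul_sub_div {s r : ℝ} (hs : 0 < s) (hr : 0 < r) :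
    ∫ x in Set.Ioi (0 : ℝ), exp (-(1 / 2) * (s * x - r / x) ^ 2) = √(2 * π) / (2 * s) := by
  obtain ⟨hint, hval⟩ := integrableOn_and_integral_deriv_mul_exp hs hr
  have hA : IntegrableOn (fun x : ℝ => s * exp (-(1 / 2) * (s * x - r / x) ^ 2))
      (Set.Ioi 0) := by
    refine hint.mono' (by fun_prop) ?_
    refine (ae_restrict_iff' measurableSet_Ioi).2 (Filter.Eventually.of_forall fun x _ => ?_)
    rw [Real.norm_of_nonneg (by positivity)]
    gcongr
    exact le_add_of_nonneg_right (by positivity)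
  have hB : IntegrableOn (fun x : ℝ => r / x ^ 2 * exp (-(1 / 2) * (s * x - r / x) ^ 2))
      (Set.Ioi 0) :=
    (hint.sub hA).congr_fun (fun x _ => by simp only [Pi.sub_apply]; ring) measurableSet_Ioi
  simp only [add_mul] at hval
  rw [integral_add hA hB, integral_exp_sq_mul_sub_div_comp_inv hs hr, integral_const_mul] at hval
  rw [← hval]
  field_simp
  ring

theorem integral_mul_inverseGaussian {s r : ℝ} (hs : 0 < s) (hr : 0 < r) :
    ∫ v in Set.Ioi (0 : ℝ), v * (r / √(2 * π) * exp (r * s) * v ^ (-(3 : ℝ) / 2) *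
        exp (-(1 / 2) * (s ^ 2 * v + r ^ 2 * v⁻¹))) = r / s := by
  rw [← integral_comp_rpow_Ioi_of_pos (p := 2) two_pos]
  have hpt : ∀ x ∈ Set.Ioi (0 : ℝ),
      ((2 : ℝ) * x ^ ((2 : ℝ) - 1)) • (x ^ (2 : ℝ) * (r / √(2 * π) * exp (r * s) *
        (x ^ (2 : ℝ)) ^ (-(3 : ℝ) / 2) *
        exp (-(1 / 2) * (s ^ 2 * x ^ (2 : ℝ) + r ^ 2 * (x ^ (2 : ℝ))⁻¹))))
      = 2 * (r / √(2 * π)) * exp (-(1 / 2) * (s * x - r / x) ^ 2) := fun x hx => by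
    have hx' : 0 < x := hx
    have h₁ : (x ^ (2 : ℝ)) ^ (-(3 : ℝ) / 2) = (x ^ 3)⁻¹ := by
      rw [← rpow_mul hx'.le, show (2 : ℝ) * (-3 / 2) = -(3 : ℕ) by norm_num, rpow_neg hx'.le,
        rpow_natCast]
    have h₂ : exp (-(1 / 2) * (s * x - r / x) ^ 2)
        = exp (r * s) * exp (-(1 / 2) * (s ^ 2 * x ^ 2 + r ^ 2 * (x ^ 2)⁻¹)) := by
      rw [← exp_add]
      congr 1
      field_simp
      ring
    rw [h₁, h₂, rpow_two, show (2 : ℝ) - 1 = 1 by norm_num, rpow_one, smul_eq_mul]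
    field_simp
  rw [setIntegral_congr_fun measurableSet_Ioi hpt, integral_const_mul,
    integral_exp_sq_mul_sub_div hs hr]
  have : 0 < √(2 * π) := by positivity
  field_simp

/-- Proposition 2, formula (4): the conditional expectation `E(V | y)` equals
`√(1 + γᵀΣ⁻¹γ) / √((y−μ)ᵀΣ⁻¹(y−μ))`. -/
theorem msl_conditional_expectation_V
    (p : ℕ) (hp : 1 ≤ p) (μ γ : Fin p → ℝ)
    (S : Matrix (Fin p) (Fin p) ℝ) (hS : S.PosDef) (y : Fin p → ℝ) (hy : y ≠ μ) :
    ∫ v in Set.Ioi (0:ℝ),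
      v * ((Real.sqrt (1 + γ ⬝ᵥ S⁻¹ *ᵥ γ) / Real.sqrt (2 * π)) *
        Real.exp (Real.sqrt (1 + γ ⬝ᵥ S⁻¹ *ᵥ γ) *
          Real.sqrt ((y - μ) ⬝ᵥ S⁻¹ *ᵥ (y - μ))) *
        v ^ (-(3:ℝ)/2) *
        Real.exp (-(1/2) * (((y - μ) ⬝ᵥ S⁻¹ *ᵥ (y - μ)) * v +
          (Real.sqrt (1 + γ ⬝ᵥ S⁻¹ *ᵥ γ)) ^ 2 * v⁻¹)))
    = Real.sqrt (1 + γ ⬝ᵥ S⁻¹ *ᵥ γ) /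
      Real.sqrt ((y - μ) ⬝ᵥ S⁻¹ *ᵥ (y - μ)) := by
  have hinv := hS.inv
  have hγ : 0 ≤ γ ⬝ᵥ S⁻¹ *ᵥ γ := by
    simpa using hinv.posSemidef.dotProduct_mulVec_nonneg γ
  have ha : 0 < (y - μ) ⬝ᵥ S⁻¹ *ᵥ (y - μ) := by
    simpa using hinv.dotProduct_mulVec_pos (sub_ne_zero.2 hy)
  have h := integral_mul_inverseGaussian (Real.sqrt_pos.2 ha)
    (Real.sqrt_pos.2 (show 0 < 1 + γ ⬝ᵥ S⁻¹ *ᵥ γ by linarith))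
  rwa [Real.sq_sqrt ha.le] at h
end

section
/- The integral underlying E(V^{-1} | y) for the MSL distribution: for all real numbers a > 0 and b > 0, ∫_0^∞ v^{-5/2} · exp( −½ (a·v + b·v^{-1}) ) dv = √(2π) · b^{-3/2} · (1 + √(a·b)) · exp(−√(a·b)). -/
open MeasureTheory Real

/-- The second moment of an unnormalized centred Gaussian. -/
theorem integral_sq_mul_exp_neg_mul_sq {c : ℝ} (hc : 0 < c) :
    ∫ u : ℝ, u ^ 2 * Real.exp (-c * u ^ 2) = √(π / c) / (2 * c) := by
  have h1 : ∫ u : ℝ, u ^ 2 * Real.exp (-c * u ^ 2)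
      = 2 * ∫ u in Set.Ioi (0 : ℝ), u ^ 2 * Real.exp (-c * u ^ 2) := by
    have h := integral_comp_abs (f := fun u : ℝ => u ^ 2 * Real.exp (-c * u ^ 2))
    simpa only [sq_abs] using h
  have h2 := integral_rpow_mul_exp_neg_mul_rpow (p := 2) (q := 2) (b := c)
    (by norm_num) (by norm_num) hc
  simp only [Real.rpow_two] at h2
  have h3 : Real.Gamma ((2 + 1) / 2) = √π / 2 := by
    rw [show ((2 : ℝ) + 1) / 2 = 1 / 2 + 1 by norm_num, Real.Gamma_add_one (by norm_num),
      Real.Gamma_one_half_eq]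
    ring
  have h4 : c ^ (-((2 : ℝ) + 1) / 2) = (c * √c)⁻¹ := by
    rw [show -((2 : ℝ) + 1) / 2 = -(1 + 1 / 2) by norm_num, Real.rpow_neg hc.le,
      Real.rpow_add hc, Real.rpow_one, Real.sqrt_eq_rpow]
  rw [h1, h2, h3, h4, Real.sqrt_div' _ hc.le]
  have := Real.sqrt_pos.2 hc
  field_simp

theorem integrable_sq_mul_exp_neg_mul_sq {c : ℝ} (hc : 0 < c) :
    Integrable fun u : ℝ => u ^ 2 * Real.exp (-c * u ^ 2) := by
  simpa only [Real.rpow_two] using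
    integrable_rpow_mul_exp_neg_mul_sq hc (s := 2) (by norm_num)

theorem integrable_cosh_three_mul_exp_sinh_sq {c : ℝ} (hc : 0 < c) :
    Integrable fun t : ℝ => Real.cosh (3 * t) * Real.exp (-c * Real.sinh t ^ 2) := by
  have h : Integrable fun u : ℝ => Real.exp (-c * u ^ 2) + 4 * (u ^ 2 * Real.exp (-c * u ^ 2)) :=
    (integrable_exp_neg_mul_sq hc).add ((integrable_sq_mul_exp_neg_mul_sq hc).const_mul 4)
  have hs := (integrableOn_image_iff_integrableOn_abs_deriv_smul MeasurableSet.univ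
    (fun t _ => (Real.hasDerivAt_sinh t).hasDerivWithinAt) Real.sinh_injective.injOn _).1
    (h.integrableOn (s := Real.sinh '' Set.univ))
  rw [integrableOn_univ] at hs
  refine hs.congr (Filter.Eventually.of_forall fun t => ?_)
  simp only [smul_eq_mul, abs_of_pos (Real.cosh_pos t), Real.cosh_three_mul]
  linear_combination (-4 * Real.cosh t * Real.exp (-c * Real.sinh t ^ 2)) * Real.cosh_sq t

theorem integral_cosh_three_mul_exp_sinh_sq {c : ℝ} (hc : 0 < c) :
    ∫ t : ℝ, Real.cosh (3 * t) * Real.exp (-c * Real.sinh t ^ 2) = √(π / c) * (1 + 2 / c) := by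
  have hs := integral_image_eq_integral_abs_deriv_smul MeasurableSet.univ
    (fun t _ => (Real.hasDerivAt_sinh t).hasDerivWithinAt) Real.sinh_injective.injOn
    (fun u : ℝ => Real.exp (-c * u ^ 2) + 4 * (u ^ 2 * Real.exp (-c * u ^ 2)))
  rw [Set.image_univ, Real.sinh_surjective.range_eq, setIntegral_univ, setIntegral_univ,
    integral_add (integrable_exp_neg_mul_sq hc)
      ((integrable_sq_mul_exp_neg_mul_sq hc).const_mul 4),
    integral_const_mul, integral_gaussian, integral_sq_mul_exp_neg_mul_sq hc] at hs
  calc _ = ∫ t : ℝ, |Real.cosh t| • (Real.exp (-c * Real.sinh t ^ 2)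
        + 4 * (Real.sinh t ^ 2 * Real.exp (-c * Real.sinh t ^ 2))) := by
        congr 1 with t
        simp only [smul_eq_mul, abs_of_pos (Real.cosh_pos t), Real.cosh_three_mul]
        linear_combination (4 * Real.cosh t * Real.exp (-c * Real.sinh t ^ 2)) * Real.cosh_sq t
    _ = _ := by
        rw [← hs]
        field_simp
        ring

theorem integral_exp_neg_three_mul_exp_sinh_sq {c : ℝ} (hc : 0 < c) :
    ∫ t : ℝ, Real.exp (-3 * t) * Real.exp (-c * Real.sinh t ^ 2) = √(π / c) * (1 + 2 / c) := by
  have hint : Integrable fun t : ℝ => Real.exp (-3 * t) * Real.exp (-c * Real.sinh t ^ 2) := by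
    refine ((integrable_cosh_three_mul_exp_sinh_sq hc).const_mul 2).mono'
      (by fun_prop) (Filter.Eventually.of_forall fun t => ?_)
    rw [Real.norm_of_nonneg (by positivity), ← mul_assoc]
    gcongr
    rw [Real.cosh_eq, ← neg_mul]
    linarith [Real.exp_pos (3 * t)]
  have hneg := integral_neg_eq_self
    (fun t : ℝ => Real.exp (-3 * t) * Real.exp (-c * Real.sinh t ^ 2)) volume
  have hadd := integral_add hint hint.comp_neg
  rw [hneg] at hadd
  have hcosh : ∫ t : ℝ, (Real.exp (-3 * t) * Real.exp (-c * Real.sinh t ^ 2)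
      + Real.exp (-3 * -t) * Real.exp (-c * Real.sinh (-t) ^ 2))
      = 2 * (√(π / c) * (1 + 2 / c)) := by
    rw [← integral_cosh_three_mul_exp_sinh_sq hc, ← integral_const_mul]
    congr 1 with t
    rw [Real.cosh_eq, Real.sinh_neg, neg_sq, neg_mul_neg, neg_mul 3 t]
    ring
  linarith

/-- The substitution `v = k * exp (2 * t)`. -/
theorem integral_Ioi_eq_integral_comp_mul_exp {k : ℝ} (hk : 0 < k) (g : ℝ → ℝ) :
    ∫ v in Set.Ioi (0 : ℝ), g v
      = ∫ t : ℝ, 2 * (k * Real.exp (2 * t)) * g (k * Real.exp (2 * t)) := by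
  have himg : (fun t : ℝ => k * Real.exp (2 * t)) '' Set.univ = Set.Ioi 0 := by
    ext v
    simp only [Set.image_univ, Set.mem_range, Set.mem_Ioi]
    refine ⟨?_, fun hv => ⟨Real.log (v / k) / 2, ?_⟩⟩
    · rintro ⟨t, rfl⟩
      positivity
    · rw [mul_div_cancel₀ _ two_ne_zero, Real.exp_log (by positivity)]
      field_simp
  have hderiv : ∀ t ∈ Set.univ, HasDerivWithinAt (fun t : ℝ => k * Real.exp (2 * t))
      (2 * (k * Real.exp (2 * t))) Set.univ t := by
    intro t _
    have h := (((hasDerivAt_id t).const_mul 2).exp.const_mul k).hasDerivWithinAt (s := Set.univ)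
    exact h.congr_deriv (by simp only [id_eq]; ring)
  have hinj : Set.InjOn (fun t : ℝ => k * Real.exp (2 * t)) Set.univ := by
    intro s _ t _ hst
    have := Real.exp_injective (mul_left_cancel₀ hk.ne' hst)
    linarith
  rw [← himg, integral_image_eq_integral_abs_deriv_smul MeasurableSet.univ hderiv hinj,
    setIntegral_univ]
  congr 1 with t
  rw [abs_of_pos (by positivity), smul_eq_mul]

/-- Integral underlying `E(V⁻¹ | y)`:
`∫_0^∞ v^{-5/2} exp(−½(av + b/v)) dv = √(2π) b^{-3/2} (1 + √(ab)) exp(−√(ab))`. -/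
theorem integral_rpow_neg_five_halves_exp
    (a b : ℝ) (ha : 0 < a) (hb : 0 < b) :
    ∫ v in Set.Ioi (0:ℝ),
      v ^ (-(5:ℝ)/2) * Real.exp (-(1/2) * (a * v + b * v⁻¹))
    = Real.sqrt (2 * π) * b ^ (-(3:ℝ)/2) * (1 + Real.sqrt (a * b)) *
      Real.exp (-Real.sqrt (a * b)) := by
  obtain ⟨w, hw⟩ : ∃ w, w = √(a * b) := ⟨_, rfl⟩
  have hw0 : 0 < w := by rw [hw]; positivity
  have hw2 : w ^ 2 = a * b := by rw [hw]; exact Real.sq_sqrt (by positivity)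
  obtain ⟨k, hk⟩ : ∃ k, k = b / w := ⟨_, rfl⟩
  have hk0 : 0 < k := by rw [hk]; positivity
  have hb' : b = k * w := by rw [hk]; field_simp
  have ha' : a = w / k := by
    rw [hk]
    field_simp
    linarith
  rw [← hw, integral_Ioi_eq_integral_comp_mul_exp hk0]
  have hpow (t : ℝ) : k * Real.exp (2 * t) * (k * Real.exp (2 * t)) ^ (-(5 : ℝ) / 2)
      = k ^ (-(3 : ℝ) / 2) * Real.exp (-3 * t) := by
    have hv : 0 < k * Real.exp (2 * t) := by positivity
    rw [← Real.rpow_one_add' hv.le (by norm_num), Real.mul_rpow hk0.le (Real.exp_pos _).le,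
      ← Real.exp_mul]
    ring_nf
  have hexp (t : ℝ) : -(1 / 2) * (a * (k * Real.exp (2 * t)) + b * (k * Real.exp (2 * t))⁻¹)
      = -w + -(2 * w) * Real.sinh t ^ 2 := by
    rw [ha', hb', mul_inv, ← Real.exp_neg, Real.sinh_eq]
    have h1 : Real.exp (2 * t) = Real.exp t ^ 2 := by rw [← Real.exp_nat_mul]; norm_num
    have h2 : Real.exp (-(2 * t)) = Real.exp (-t) ^ 2 := by
      rw [← Real.exp_nat_mul]; congr 1; push_cast; ring
    have h3 : Real.exp t * Real.exp (-t) = 1 := by rw [← Real.exp_add]; simp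
    rw [h1, h2]
    field_simp
    linear_combination (-2 : ℝ) * h3
  have hfun (t : ℝ) : 2 * (k * Real.exp (2 * t)) * ((k * Real.exp (2 * t)) ^ (-(5 : ℝ) / 2)
      * Real.exp (-(1 / 2) * (a * (k * Real.exp (2 * t)) + b * (k * Real.exp (2 * t))⁻¹)))
      = 2 * k ^ (-(3 : ℝ) / 2) * Real.exp (-w)
        * (Real.exp (-3 * t) * Real.exp (-(2 * w) * Real.sinh t ^ 2)) := by
    rw [hexp, Real.exp_add]
    linear_combination (2 * Real.exp (-w) * Real.exp (-(2 * w) * Real.sinh t ^ 2)) * hpow t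
  simp only [hfun]
  rw [integral_const_mul, integral_exp_neg_three_mul_exp_sinh_sq (by positivity)]
  have hwp : w ^ (-(3 : ℝ) / 2) = (w * √w)⁻¹ := by
    rw [show -(3 : ℝ) / 2 = -(1 + 1 / 2) by norm_num, Real.rpow_neg hw0.le,
      Real.rpow_add hw0, Real.rpow_one, Real.sqrt_eq_rpow]
  have hsq : √(π / (2 * w)) = √(2 * π) / (2 * √w) := by
    rw [show π / (2 * w) = 2 * π / (2 ^ 2 * w) by field_simp,
      Real.sqrt_div (by positivity), Real.sqrt_mul (by positivity) w, Real.sqrt_sq (by norm_num)]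
  have := Real.sqrt_pos.2 hw0
  rw [hb', Real.mul_rpow hk0.le hw0.le, hwp, hsq]
  field_simp
  ring
end
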